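/- (Theorem A, sign direction.) Let g₁, g₂ ∈ SO(2,1)⁰ generate a discrete, free group of rank two, set g₃ := (g₂g₁)⁻¹, and assume each gᵢ is hyperbolic or parabolic. Let γᵢ(x) = gᵢx + uᵢ be affine isometries with γ₃γ₂γ₁ = id, and suppose the group generated by γ₁ and γ₂ acts properly discontinuously and freely on ℝ³. Then the signs of γ₁, γ₂, γ₃ are all equal and nonzero: the Margulis invariants α(γ₁), α(γ₂), α(γ₃), computed with respect to positive fixed vectors, are either all strictly positive or all strictly negative. -/

import Mathlib

open Matrix

noncomputable section

/-- Minkowski space: ℝ³. -/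
abbrev V3 : Type := Fin 3 → ℝ

/-- The Lorentzian inner product `x·y = x₁y₁ + x₂y₂ − x₃y₃`. -/
def mdot (x y : V3) : ℝ := x 0 * y 0 + x 1 * y 1 - x 2 * y 2

/-- The Lorentzian cross product: the unique bilinear map with
`mdot u (lcross v w) = det [u v w]` (columns `u`, `v`, `w`). -/
def lcross (v w : V3) : V3 :=
  ![v 1 * w 2 - v 2 * w 1, v 2 * w 0 - v 0 * w 2, -(v 0 * w 1 - v 1 * w 0)]

/-- For a spacelike vector `v`, the future-pointing null vector `v⁺` of Euclidean
length 1 which is Lorentz-orthogonal to `v`, where `v⁻, v⁺` are ordered so that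
`det[v⁻ v⁺ v] > 0`. -/
def nullPlus (v : V3) : V3 :=
  (1 / (Real.sqrt 2 * (v 0 ^ 2 + v 1 ^ 2))) •
    ![v 0 * v 2 + v 1 * Real.sqrt (mdot v v),
      v 1 * v 2 - v 0 * Real.sqrt (mdot v v),
      v 0 ^ 2 + v 1 ^ 2]

/-- For a spacelike vector `v`, the future-pointing null vector `v⁻` of Euclidean
length 1 which is Lorentz-orthogonal to `v`, where `v⁻, v⁺` are ordered so that
`det[v⁻ v⁺ v] > 0`. -/
def nullMinus (v : V3) : V3 :=
  (1 / (Real.sqrt 2 * (v 0 ^ 2 + v 1 ^ 2))) •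
    ![v 0 * v 2 - v 1 * Real.sqrt (mdot v v),
      v 1 * v 2 + v 0 * Real.sqrt (mdot v v),
      v 0 ^ 2 + v 1 ^ 2]

/-- `P(x)`: for a future-pointing null vector `x`, the set of spacelike vectors `w`
with `w·x = 0` such that `(w/√(w·w))⁺` is a positive scalar multiple of `x`. -/
def wingSet (x : V3) : Set V3 :=
  {w | 0 < mdot w w ∧ mdot w x = 0 ∧
    ∃ t : ℝ, 0 < t ∧ nullPlus ((Real.sqrt (mdot w w))⁻¹ • w) = t • x}

/-- The crooked plane `C(v,p)`: union of the stem `p + {x | x·v = 0, x·x ≤ 0}`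
and the wings `p + P(v⁺)` and `p + P(v⁻)`. -/
def crookedPlane (v p : V3) : Set V3 :=
  {q | mdot (q - p) v = 0 ∧ mdot (q - p) (q - p) ≤ 0} ∪
  {q | q - p ∈ wingSet (nullPlus v)} ∪
  {q | q - p ∈ wingSet (nullMinus v)}

/-- The crooked half-space `H(v,p)`. -/
def crookedHalf (v p : V3) : Set V3 :=
  {q | (0 ≤ mdot (q - p) v → mdot (q - p) (nullPlus v) ≤ 0) ∧
       (mdot (q - p) v ≤ 0 → 0 ≤ mdot (q - p) (nullMinus v))}

/-- Spacelike vectors `u`, `v` are consistently oriented. -/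
def consistentlyOriented (u v : V3) : Prop :=
  mdot u v < 0 ∧ mdot u (nullPlus v) ≤ 0 ∧ mdot u (nullMinus v) ≤ 0 ∧
  mdot v (nullPlus u) ≤ 0 ∧ mdot v (nullMinus u) ≤ 0

/-- `g` is a linear isometry of the Lorentzian inner product. -/
def isLorentz (g : Matrix (Fin 3) (Fin 3) ℝ) : Prop :=
  ∀ x y : V3, mdot (g.mulVec x) (g.mulVec y) = mdot x y

/-- Membership in `SO(2,1)⁰`, the identity component of the group of linear
isometries of `mdot`: Lorentzian, determinant one, and orthochronous. -/
def inSO21p (g : Matrix (Fin 3) (Fin 3) ℝ) : Prop :=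
  isLorentz g ∧ g.det = 1 ∧ 0 < g.mulVec ![0, 0, 1] 2

/-- `g` is hyperbolic: it has three distinct real eigenvalues. -/
def isHyperbolic (g : Matrix (Fin 3) (Fin 3) ℝ) : Prop :=
  ∃ a b c : ℝ, a ≠ b ∧ a ≠ c ∧ b ≠ c ∧
    g.charpoly = (Polynomial.X - Polynomial.C a) * (Polynomial.X - Polynomial.C b) *
      (Polynomial.X - Polynomial.C c)

/-- `g ≠ I` is parabolic: `1` is its only eigenvalue. -/
def isParabolic (g : Matrix (Fin 3) (Fin 3) ℝ) : Prop :=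
  g ≠ 1 ∧ g.charpoly = (Polynomial.X - Polynomial.C 1) ^ 3

/-- `v` is a positive fixed vector of `g`: `gv = v`, `v ≠ 0`, and
`det[v x gx] > 0` for some null or timelike `x` which is not an eigenvector. -/
def positiveFixed (g : Matrix (Fin 3) (Fin 3) ℝ) (v : V3) : Prop :=
  v ≠ 0 ∧ g.mulVec v = v ∧
  ∃ x : V3, mdot x x ≤ 0 ∧ (∀ t : ℝ, g.mulVec x ≠ t • x) ∧
    0 < mdot v (lcross x (g.mulVec x))

/-- A subgroup of homeomorphisms (here: permutations) of ℝ³ acts properly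
discontinuously: for every compact `K`, only finitely many elements move `K`
to meet `K`. -/
def properlyDisc (Γ : Subgroup (Equiv.Perm V3)) : Prop :=
  ∀ K : Set V3, IsCompact K →
    {f : Equiv.Perm V3 | f ∈ Γ ∧ ((f : V3 → V3) '' K ∩ K).Nonempty}.Finite

/-- The action of `Γ` on ℝ³ is free: no nonidentity element has a fixed point. -/
def freeAction (Γ : Subgroup (Equiv.Perm V3)) : Prop :=
  ∀ f ∈ Γ, f ≠ 1 → ∀ x : V3, f x ≠ x

section LorentzAlgebra

lemma mdot_comm (x y : V3) : mdot x y = mdot y x := by simp only [mdot]; ring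

@[simp] lemma mdot_add_left (x y z : V3) : mdot (x + y) z = mdot x z + mdot y z := by
  simp only [mdot, Pi.add_apply]; ring

@[simp] lemma mdot_add_right (x y z : V3) : mdot x (y + z) = mdot x y + mdot x z := by
  simp only [mdot, Pi.add_apply]; ring

@[simp] lemma mdot_sub_left (x y z : V3) : mdot (x - y) z = mdot x z - mdot y z := by
  simp only [mdot, Pi.sub_apply]; ring

@[simp] lemma mdot_sub_right (x y z : V3) : mdot x (y - z) = mdot x y - mdot x z := by
  simp only [mdot, Pi.sub_apply]; ring

@[simp] lemma mdot_neg_left (x y : V3) : mdot (-x) y = -mdot x y := by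
  simp only [mdot, Pi.neg_apply]; ring

@[simp] lemma mdot_neg_right (x y : V3) : mdot x (-y) = -mdot x y := by
  simp only [mdot, Pi.neg_apply]; ring

@[simp] lemma mdot_smul_left (t : ℝ) (x y : V3) : mdot (t • x) y = t * mdot x y := by
  simp only [mdot, Pi.smul_apply, smul_eq_mul]; ring

@[simp] lemma mdot_smul_right (t : ℝ) (x y : V3) : mdot x (t • y) = t * mdot x y := by
  simp only [mdot, Pi.smul_apply, smul_eq_mul]; ring

@[simp] lemma mdot_zero_left (y : V3) : mdot 0 y = 0 := by simp [mdot]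

/-- A vector orthogonal to every vector vanishes. -/
lemma eq_zero_of_mdot (x : V3) (h : ∀ y, mdot x y = 0) : x = 0 := by
  have h0 := h ![1, 0, 0]
  have h1 := h ![0, 1, 0]
  have h2 := h ![0, 0, 1]
  simp [mdot] at h0 h1 h2
  ext i; fin_cases i <;> simp_all

lemma exists_mdot_eq_one {x : V3} (hx : x ≠ 0) : ∃ e, mdot x e = 1 := by
  by_contra! h
  refine hx (eq_zero_of_mdot x fun y => ?_)
  by_contra hy
  refine h ((mdot x y)⁻¹ • y) ?_
  rw [mdot_smul_right, inv_mul_cancel₀ hy]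

@[simp] lemma lcross_add_left (x y z : V3) : lcross (x + y) z = lcross x z + lcross y z := by
  ext i; fin_cases i <;> simp [lcross] <;> ring

@[simp] lemma lcross_add_right (x y z : V3) : lcross x (y + z) = lcross x y + lcross x z := by
  ext i; fin_cases i <;> simp [lcross] <;> ring

@[simp] lemma lcross_sub_right (x y z : V3) : lcross x (y - z) = lcross x y - lcross x z := by
  ext i; fin_cases i <;> simp [lcross] <;> ring

@[simp] lemma lcross_smul_left (t : ℝ) (x y : V3) : lcross (t • x) y = t • lcross x y := by
  ext i; fin_cases i <;> simp [lcross] <;> ring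

@[simp] lemma lcross_smul_right (t : ℝ) (x y : V3) : lcross x (t • y) = t • lcross x y := by
  ext i; fin_cases i <;> simp [lcross] <;> ring

@[simp] lemma lcross_self (x : V3) : lcross x x = 0 := by
  ext i; fin_cases i <;> simp [lcross] <;> ring

@[simp] lemma mdot_lcross_self_left (x y : V3) : mdot x (lcross x y) = 0 := by
  simp [mdot, lcross]; ring

@[simp] lemma mdot_lcross_self_right (x y : V3) : mdot y (lcross x y) = 0 := by
  simp [mdot, lcross]; ring

lemma mdot_lcross_cyclic (x y z : V3) : mdot x (lcross y z) = mdot z (lcross x y) := by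
  simp [mdot, lcross]; ring

lemma lcross_lcross (x y z : V3) :
    lcross x (lcross y z) = mdot x y • z - mdot x z • y := by
  ext i; fin_cases i <;> simp [lcross, mdot] <;> ring

lemma mdot_lcross_lcross (a b c d : V3) :
    mdot (lcross a b) (lcross c d) = mdot a d * mdot b c - mdot a c * mdot b d := by
  simp [lcross, mdot]; ring

/-- Expansion of a vector in the basis `a, b, c` (Cramer's rule). -/
lemma cramer_expansion (a b c z : V3) :
    mdot a (lcross b c) • z =
      mdot z (lcross b c) • a + mdot z (lcross c a) • b + mdot z (lcross a b) • c := by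
  ext i; fin_cases i <;> simp [lcross, mdot] <;> ring

lemma exists_smul_of_lcross_eq_zero {a b : V3} (ha : a ≠ 0) (h : lcross a b = 0) :
    ∃ t : ℝ, b = t • a := by
  obtain ⟨e, he⟩ := exists_mdot_eq_one ha
  have h1 := lcross_lcross e a b
  rw [h, mdot_comm e a, he] at h1
  refine ⟨mdot e b, ?_⟩
  have h0 : lcross e 0 = 0 := by ext i; fin_cases i <;> simp [lcross]
  rw [h0, one_smul] at h1
  exact (sub_eq_zero.mp h1.symm)

lemma null_apply_two_ne_zero {x : V3} (hx : x ≠ 0) (h : mdot x x = 0) : x 2 ≠ 0 := by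
  intro h2
  apply hx
  simp only [mdot, h2] at h
  have h0 : x 0 = 0 := by nlinarith [sq_nonneg (x 0), sq_nonneg (x 1)]
  have h1 : x 1 = 0 := by nlinarith [sq_nonneg (x 0), sq_nonneg (x 1)]
  ext i; fin_cases i <;> simp_all

/-- Orthogonal null vectors are parallel. -/
lemma null_parallel {x y : V3} (hx : x ≠ 0) (hxx : mdot x x = 0) (hyy : mdot y y = 0)
    (hxy : mdot x y = 0) : ∃ t : ℝ, y = t • x := by
  have h2 := null_apply_two_ne_zero hx hxx
  refine ⟨y 2 / x 2, ?_⟩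
  have key : (y 0 * x 2 - y 2 * x 0) ^ 2 + (y 1 * x 2 - y 2 * x 1) ^ 2 = 0 := by
    simp only [mdot] at *
    linear_combination (x 2) ^ 2 * hyy + (y 2) ^ 2 * hxx - 2 * (x 2) * (y 2) * hxy
  have k0 : y 0 * x 2 - y 2 * x 0 = 0 := by
    nlinarith [sq_nonneg (y 0 * x 2 - y 2 * x 0), sq_nonneg (y 1 * x 2 - y 2 * x 1)]
  have k1 : y 1 * x 2 - y 2 * x 1 = 0 := by
    nlinarith [sq_nonneg (y 0 * x 2 - y 2 * x 0), sq_nonneg (y 1 * x 2 - y 2 * x 1)]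
  ext i; fin_cases i <;> simp <;> field_simp <;> linarith

/-- Two null vectors in the same time cone have nonpositive inner product. -/
lemma mdot_nonpos_of_null {x y : V3} (hxx : mdot x x = 0) (hyy : mdot y y = 0)
    (h : 0 < x 2 * y 2) : mdot x y ≤ 0 := by
  simp only [mdot] at *
  have : (x 0 * y 0 + x 1 * y 1) ^ 2 ≤ (x 2 * y 2) ^ 2 := by
    have e : (x 2 * y 2) ^ 2 = (x 0 ^ 2 + x 1 ^ 2) * (y 0 ^ 2 + y 1 ^ 2) := by
      linear_combination (-(y 2)^2) * hxx - (x 0 ^ 2 + x 1 ^ 2) * hyy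
    rw [e]; nlinarith [sq_nonneg (x 0 * y 1 - x 1 * y 0)]
  linarith [(abs_le.mp (abs_le_of_sq_le_sq this h.le)).2]

end LorentzAlgebra

section Matrices

/-- The adjoint of a matrix with respect to `mdot`. -/
def ladj (g : Matrix (Fin 3) (Fin 3) ℝ) : Matrix (Fin 3) (Fin 3) ℝ :=
  !![g 0 0, g 1 0, -g 2 0; g 0 1, g 1 1, -g 2 1; -g 0 2, -g 1 2, g 2 2]

/-- The matrix of `x ↦ lcross f x`. -/
def crossMat (f : V3) : Matrix (Fin 3) (Fin 3) ℝ :=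
  !![0, -f 2, f 1; f 2, 0, -f 0; f 1, -f 0, 0]

/-- The vector `f` such that `g - ladj g` is `x ↦ lcross f x`. -/
def axial (g : Matrix (Fin 3) (Fin 3) ℝ) : V3 :=
  ![-(g 1 2 + g 2 1), g 0 2 + g 2 0, g 1 0 - g 0 1]

lemma crossMat_mulVec (f x : V3) : (crossMat f).mulVec x = lcross f x := by
  ext i; fin_cases i <;> simp [crossMat, lcross, Matrix.mulVec, dotProduct, Fin.sum_univ_three] <;>
    ring

lemma crossMat_axial (g : Matrix (Fin 3) (Fin 3) ℝ) : crossMat (axial g) = g - ladj g := by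
  ext i j; fin_cases i <;> fin_cases j <;> simp [crossMat, axial, ladj] <;> ring

lemma mdot_mulVec_left (g : Matrix (Fin 3) (Fin 3) ℝ) (x y : V3) :
    mdot (g.mulVec x) y = mdot x ((ladj g).mulVec y) := by
  simp [mdot, ladj, Matrix.mulVec, dotProduct, Fin.sum_univ_three]; ring

lemma trace_lcross (g : Matrix (Fin 3) (Fin 3) ℝ) (a b c : V3) :
    mdot (g.mulVec a) (lcross b c) + mdot a (lcross (g.mulVec b) c) +
      mdot a (lcross b (g.mulVec c)) = g.trace * mdot a (lcross b c) := by
  simp [mdot, lcross, Matrix.mulVec, dotProduct, Fin.sum_univ_three, Matrix.trace]; ring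

lemma det_lcross (g : Matrix (Fin 3) (Fin 3) ℝ) (a b c : V3) :
    mdot (g.mulVec a) (lcross (g.mulVec b) (g.mulVec c)) = g.det * mdot a (lcross b c) := by
  simp [mdot, lcross, Matrix.mulVec, dotProduct, Fin.sum_univ_three, Matrix.det_fin_three]; ring

lemma sq_sub_trace_smul (g : Matrix (Fin 3) (Fin 3) ℝ) :
    g * g - g.trace • g + g.adjugate.trace • (1 : Matrix (Fin 3) (Fin 3) ℝ) = g.adjugate := by
  ext i j; fin_cases i <;> fin_cases j <;>
    simp [Matrix.mul_apply, Fin.sum_univ_three, Matrix.trace, Matrix.adjugate_fin_three] <;> ring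

lemma det_smul_one_sub (g : Matrix (Fin 3) (Fin 3) ℝ) (t : ℝ) :
    (t • (1 : Matrix (Fin 3) (Fin 3) ℝ) - g).det =
      t ^ 3 - g.trace * t ^ 2 + g.adjugate.trace * t - g.det := by
  simp [Matrix.det_fin_three, Matrix.trace, Fin.sum_univ_three, Matrix.adjugate_fin_three]; ring

lemma axial_add (g h : Matrix (Fin 3) (Fin 3) ℝ) : axial (g + h) = axial g + axial h := by
  ext i; fin_cases i <;> simp [axial] <;> ring

lemma axial_smul (t : ℝ) (g : Matrix (Fin 3) (Fin 3) ℝ) : axial (t • g) = t • axial g := by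
  ext i; fin_cases i <;> simp [axial] <;> ring

lemma axial_crossMat_mul (f : V3) (h : Matrix (Fin 3) (Fin 3) ℝ) :
    axial (crossMat f * h) = h.trace • f - h.mulVec f := by
  ext i; fin_cases i <;>
    simp [axial, crossMat, Matrix.mul_apply, Matrix.mulVec, dotProduct, Fin.sum_univ_three,
      Matrix.trace] <;> ring

lemma axial_crossMat_sq_mul (f : V3) (h : Matrix (Fin 3) (Fin 3) ℝ) :
    axial (crossMat f * crossMat f * h) =
      mdot f f • axial h - lcross f ((ladj h).mulVec f) := by
  ext i; fin_cases i <;>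
    simp [axial, crossMat, Matrix.mul_apply, Matrix.mulVec, dotProduct, Fin.sum_univ_three,
      mdot, lcross, ladj] <;> ring

lemma trace_crossMat_sq_mul (f : V3) (h : Matrix (Fin 3) (Fin 3) ℝ) :
    (crossMat f * crossMat f * h).trace = mdot f f * h.trace - mdot f (h.mulVec f) := by
  simp [crossMat, Matrix.vecMul, Matrix.mulVec, dotProduct, Fin.sum_univ_three,
      mdot, Matrix.trace]; ring

end Matrices

section Lorentz

variable {g h : Matrix (Fin 3) (Fin 3) ℝ}

lemma ladj_mul_self (hg : isLorentz g) : ladj g * g = 1 := by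
  apply Matrix.mulVec_injective
  funext y
  rw [← sub_eq_zero]
  refine eq_zero_of_mdot _ fun x => ?_
  rw [mdot_comm, mdot_sub_right, ← Matrix.mulVec_mulVec, ← mdot_mulVec_left, hg, Matrix.one_mulVec,
    sub_self]

lemma self_mul_ladj (hg : isLorentz g) : g * ladj g = 1 :=
  mul_eq_one_comm.mp (ladj_mul_self hg)

lemma ladj_mulVec_mulVec (hg : isLorentz g) (x : V3) : (ladj g).mulVec (g.mulVec x) = x := by
  rw [Matrix.mulVec_mulVec, ladj_mul_self hg, Matrix.one_mulVec]

lemma mulVec_ladj_mulVec (hg : isLorentz g) (x : V3) : g.mulVec ((ladj g).mulVec x) = x := by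
  rw [Matrix.mulVec_mulVec, self_mul_ladj hg, Matrix.one_mulVec]

lemma ladj_ladj (g : Matrix (Fin 3) (Fin 3) ℝ) : ladj (ladj g) = g := by
  ext i j; fin_cases i <;> fin_cases j <;> simp [ladj]

lemma isLorentz_ladj (hg : isLorentz g) : isLorentz (ladj g) := by
  intro x y
  rw [mdot_mulVec_left, ladj_ladj, mulVec_ladj_mulVec hg]

lemma adjugate_eq_ladj (hg : isLorentz g) (hd : g.det = 1) : g.adjugate = ladj g := by
  have h1 : g.adjugate * g = 1 := by rw [Matrix.adjugate_mul, hd, one_smul]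
  calc g.adjugate = g.adjugate * (g * ladj g) := by rw [self_mul_ladj hg, mul_one]
    _ = ladj g := by rw [← mul_assoc, h1, one_mul]

lemma trace_ladj (g : Matrix (Fin 3) (Fin 3) ℝ) : (ladj g).trace = g.trace := by
  simp [ladj, Matrix.trace, Fin.sum_univ_three]

lemma mulVec_lcross (hg : isLorentz g) (hd : g.det = 1) (x y : V3) :
    g.mulVec (lcross x y) = lcross (g.mulVec x) (g.mulVec y) := by
  rw [← sub_eq_zero]
  refine eq_zero_of_mdot _ fun z => ?_
  rw [← mulVec_ladj_mulVec hg z, mdot_sub_left, hg, mdot_comm (lcross _ _) (g.mulVec _), det_lcross,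
    hd, one_mul, mdot_comm, sub_self]

lemma lcross_axial (g : Matrix (Fin 3) (Fin 3) ℝ) (x : V3) :
    lcross (axial g) x = g.mulVec x - (ladj g).mulVec x := by
  rw [← crossMat_mulVec, crossMat_axial, Matrix.sub_mulVec]

lemma crossMat_injective : Function.Injective crossMat := by
  intro a b hab
  have h0 := congrFun (congrFun hab 1) 2
  have h1 := congrFun (congrFun hab 0) 2
  have h2 := congrFun (congrFun hab 1) 0
  simp [crossMat] at h0 h1 h2
  ext i; fin_cases i <;> simp_all

lemma crossMat_conj (hg : isLorentz g) (hd : g.det = 1) (f : V3) :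
    g * crossMat f * ladj g = crossMat (g.mulVec f) := by
  apply Matrix.mulVec_injective
  funext x
  rw [← Matrix.mulVec_mulVec, ← Matrix.mulVec_mulVec, crossMat_mulVec, crossMat_mulVec,
    mulVec_lcross hg hd, mulVec_ladj_mulVec hg]

lemma axial_fixed (hg : isLorentz g) (hd : g.det = 1) : g.mulVec (axial g) = axial g := by
  apply crossMat_injective
  rw [← crossMat_conj hg hd, crossMat_axial, mul_sub, sub_mul, self_mul_ladj hg, one_mul, mul_assoc,
    self_mul_ladj hg, mul_one]

lemma crossMat_sq_axial (hg : isLorentz g) (hd : g.det = 1) :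
    crossMat (axial g) * crossMat (axial g) =
      (g.trace + 1) • (g + ladj g - (2 : ℝ) • (1 : Matrix (Fin 3) (Fin 3) ℝ)) := by
  have e1 := sq_sub_trace_smul g
  rw [adjugate_eq_ladj hg hd, trace_ladj] at e1
  have hd' : (ladj g).det = 1 := by
    have := congrArg Matrix.det (self_mul_ladj hg)
    rwa [Matrix.det_mul, hd, one_mul, Matrix.det_one] at this
  have e2 := sq_sub_trace_smul (ladj g)
  rw [adjugate_eq_ladj (isLorentz_ladj hg) hd', trace_ladj, ladj_ladj] at e2
  have e3 : g * g = ladj g + g.trace • g - g.trace • (1 : Matrix (Fin 3) (Fin 3) ℝ) := by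
    rw [← e1]; abel
  have e4 : ladj g * ladj g =
      g + (g.trace • ladj g - g.trace • (1 : Matrix (Fin 3) (Fin 3) ℝ)) := by
    rwa [sub_add, sub_eq_iff_eq_add] at e2
  rw [crossMat_axial, sub_mul, mul_sub, mul_sub, ladj_mul_self hg, self_mul_ladj hg, e3, e4]
  module

/-- Rodrigues-type formula: a Lorentz matrix is determined by its trace and axial vector. -/
lemma rodrigues (hg : isLorentz g) (hd : g.det = 1) (hT : g.trace + 1 ≠ 0) :
    g = 1 + (1 / 2 : ℝ) • crossMat (axial g) +
      (1 / (2 * (g.trace + 1))) • (crossMat (axial g) * crossMat (axial g)) := by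
  rw [crossMat_sq_axial hg hd, smul_smul, crossMat_axial]
  have : 1 / (2 * (g.trace + 1)) * (g.trace + 1) = 1 / 2 := by field_simp
  rw [this]
  module

lemma rodrigues_mulVec (hg : isLorentz g) (hd : g.det = 1) (hT : g.trace + 1 ≠ 0) (x : V3) :
    g.mulVec x = x + (1 / 2 : ℝ) • lcross (axial g) x +
      (1 / (2 * (g.trace + 1))) • lcross (axial g) (lcross (axial g) x) := by
  conv_lhs => rw [rodrigues hg hd hT]
  simp only [Matrix.add_mulVec, Matrix.one_mulVec, Matrix.smul_mulVec, ← Matrix.mulVec_mulVec,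
    crossMat_mulVec]

lemma mdot_axial_self (hg : isLorentz g) (hd : g.det = 1) :
    mdot (axial g) (axial g) = (g.trace - 3) * (g.trace + 1) := by
  have h1 := congrArg Matrix.trace (crossMat_sq_axial hg hd)
  have h2 := trace_crossMat_sq_mul (axial g) 1
  rw [mul_one, Matrix.one_mulVec] at h2
  rw [h2] at h1
  simp [trace_ladj, Matrix.trace_one] at h1
  linarith

lemma det_smul_one_sub_lorentz (hg : isLorentz g) (hd : g.det = 1) (t : ℝ) :
    (t • (1 : Matrix (Fin 3) (Fin 3) ℝ) - g).det =
      t ^ 3 - g.trace * t ^ 2 + g.trace * t - 1 := by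
  rw [det_smul_one_sub, adjugate_eq_ladj hg hd, trace_ladj, hd]

lemma ladj_mulVec_of_eigen (hg : isLorentz g) {x : V3} {t : ℝ} (ht : t ≠ 0)
    (hx : g.mulVec x = t • x) : (ladj g).mulVec x = t⁻¹ • x := by
  have := ladj_mulVec_mulVec hg x
  rw [hx, Matrix.mulVec_smul] at this
  rw [eq_inv_smul_iff₀ ht, this]

lemma lcross_axial_of_eigen (hg : isLorentz g) {x : V3} {t : ℝ} (ht : t ≠ 0)
    (hx : g.mulVec x = t • x) : lcross (axial g) x = (t - t⁻¹) • x := by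
  rw [lcross_axial, hx, ladj_mulVec_of_eigen hg ht hx, sub_smul]

/-- The trace is determined by the eigenvalue of a null eigenvector. -/
lemma trace_of_null_eigen (hg : isLorentz g) (hd : g.det = 1) {x : V3} {t : ℝ} (ht : t ≠ 0)
    (hx0 : x ≠ 0) (hxx : mdot x x = 0) (hx : g.mulVec x = t • x) : g.trace = 1 + t + t⁻¹ := by
  obtain ⟨e, he⟩ := exists_mdot_eq_one hx0
  have hxe : mdot x (g.mulVec e) = t⁻¹ := by
    rw [mdot_comm, mdot_mulVec_left, ladj_mulVec_of_eigen hg ht hx, mdot_smul_right, mdot_comm e, he,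
      mul_one]
  have key := trace_lcross g x e (lcross x e)
  have c1 : ∀ a b c : V3, mdot a (lcross b c) = mdot c (lcross a b) := mdot_lcross_cyclic
  rw [mulVec_lcross hg hd, hx, c1, c1 x (g.mulVec e), c1 x e, c1 x e] at key
  simp only [mdot_lcross_lcross, lcross_smul_left, mdot_smul_left, mdot_smul_right, hxx, he,
    mdot_comm e x, hxe, mdot_comm (g.mulVec e) x] at key
  have : t * t⁻¹ = 1 := mul_inv_cancel₀ ht
  linear_combination -key + this

/-- The image of `g - 1` contains the orthogonal complement of the axial vector. -/
lemma exists_mulVec_sub_eq (hg : isLorentz g) (hd : g.det = 1) (hT : g.trace + 1 ≠ 0)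
    (hf : axial g ≠ 0) {z : V3} (hz : mdot z (axial g) = 0) : ∃ o, g.mulVec o - o = z := by
  obtain ⟨e, he⟩ := exists_mdot_eq_one hf
  have hff := mdot_axial_self hg hd
  set f := axial g with hfdef
  have hy : lcross f (lcross e z) = z := by
    rw [lcross_lcross, he, mdot_comm, hz, one_smul, zero_smul, sub_zero]
  set y := lcross e z
  have h4 : lcross f (lcross f z) = ((g.trace - 3) * (g.trace + 1)) • z := by
    rw [lcross_lcross, mdot_comm f z, hz, zero_smul, sub_zero, hff]
  refine ⟨(2 : ℝ) • y - (1 / 2 : ℝ) • z + (1 / (2 * (g.trace + 1))) • lcross f z, ?_⟩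
  rw [rodrigues_mulVec hg hd hT]
  simp only [← hfdef, lcross_add_right, lcross_sub_right, lcross_smul_right, h4, hy]
  match_scalars <;> field_simp <;> ring

/-- A positive fixed vector is a positive multiple of the axial vector. -/
lemma exists_pos_smul_axial (hg : isLorentz g) (hd : g.det = 1) (hT : 3 ≤ g.trace)
    (hf : axial g ≠ 0) {v : V3} (hv : positiveFixed g v) : ∃ t : ℝ, 0 < t ∧ v = t • axial g := by
  obtain ⟨-, hgv, x, hxx, -, hpos⟩ := hv
  have h0 : lcross (axial g) v = 0 := by
    rw [lcross_axial_of_eigen hg one_ne_zero (by rw [hgv, one_smul])]; simp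
  obtain ⟨t, rfl⟩ := exists_smul_of_lcross_eq_zero hf h0
  refine ⟨t, ?_, rfl⟩
  have hff := mdot_axial_self hg hd
  have key : mdot (axial g) (lcross x (g.mulVec x)) =
      1 / 2 * (mdot (axial g) x ^ 2 - mdot (axial g) (axial g) * mdot x x) := by
    rw [mdot_lcross_cyclic, rodrigues_mulVec hg hd (by linarith)]
    have h1 : mdot x (lcross (axial g) x) = 0 := mdot_lcross_self_right _ _
    have h2 : mdot (lcross (axial g) (lcross (axial g) x)) (lcross (axial g) x) = 0 := by
      rw [mdot_comm, mdot_lcross_self_right]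
    simp only [mdot_add_left, mdot_smul_left, h1, h2]
    rw [mdot_lcross_lcross, mdot_comm x (axial g)]
    ring
  rw [mdot_smul_left, key] at hpos
  have hff' : 0 ≤ mdot (axial g) (axial g) := by rw [hff]; nlinarith
  have : 0 ≤ 1 / 2 * (mdot (axial g) x ^ 2 - mdot (axial g) (axial g) * mdot x x) := by
    nlinarith [sq_nonneg (mdot (axial g) x), mul_nonneg hff' (neg_nonneg.mpr hxx)]
  by_contra! hle
  nlinarith [mul_nonneg (neg_nonneg.mpr hle) this]

/-- Orthochronous Lorentz matrices preserve the future cone. -/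
lemma future_mulVec (hg : inSO21p g) {x : V3} (hxx : mdot x x ≤ 0) (hx : 0 < x 2) :
    0 < g.mulVec x 2 := by
  obtain ⟨hl, -, hpos⟩ := hg
  have h22 := congrFun (congrFun (self_mul_ladj hl) 2) 2
  simp [ladj, Matrix.mul_apply, Fin.sum_univ_three] at h22
  simp [Matrix.mulVec, dotProduct, Fin.sum_univ_three, mdot] at *
  have h1 : 0 < g 2 2 * x 2 := mul_pos hpos hx
  have h2 : (g 2 0 * x 0 + g 2 1 * x 1) ^ 2 < (g 2 2 * x 2) ^ 2 := by
    have hx2 : 0 < x 2 ^ 2 := by positivity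
    have e : (g 2 2 * x 2) ^ 2 = x 2 ^ 2 + (g 2 0 ^ 2 + g 2 1 ^ 2) * x 2 ^ 2 := by
      linear_combination x 2 ^ 2 * h22
    have h3 : x 0 ^ 2 + x 1 ^ 2 ≤ x 2 ^ 2 := by linarith
    have h4 := mul_le_mul_of_nonneg_left h3 (by positivity : 0 ≤ g 2 0 ^ 2 + g 2 1 ^ 2)
    rw [e]
    nlinarith [sq_nonneg (g 2 0 * x 1 - g 2 1 * x 0)]
  have := abs_lt_of_sq_lt_sq h2 h1.le
  linarith [(abs_lt.mp this).1]

lemma inSO21p_one : inSO21p 1 := by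
  refine ⟨fun x y => by simp, Matrix.det_one, by simp⟩

lemma inSO21p_mul (hg : inSO21p g) (hh : inSO21p h) : inSO21p (g * h) := by
  refine ⟨fun x y => ?_, by rw [Matrix.det_mul, hg.2.1, hh.2.1, one_mul], ?_⟩
  · rw [← Matrix.mulVec_mulVec, ← Matrix.mulVec_mulVec, hg.1, hh.1]
  · rw [← Matrix.mulVec_mulVec]
    refine future_mulVec hg ?_ hh.2.2
    rw [hh.1]
    simp [mdot]

lemma inSO21p_ladj (hg : inSO21p g) : inSO21p (ladj g) := by
  refine ⟨isLorentz_ladj hg.1, ?_, ?_⟩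
  · have := congrArg Matrix.det (self_mul_ladj hg.1)
    rwa [Matrix.det_mul, hg.2.1, one_mul, Matrix.det_one] at this
  · have := hg.2.2
    simpa [ladj, Matrix.mulVec, dotProduct, Fin.sum_univ_three] using this

/-- A null eigenvector of an orthochronous Lorentz matrix has positive eigenvalue. -/
lemma null_eigen_pos (hg : inSO21p g) {x : V3} {t : ℝ} (hx0 : x ≠ 0) (hxx : mdot x x = 0)
    (hx : g.mulVec x = t • x) : 0 < t := by
  have h2 := null_apply_two_ne_zero hx0 hxx
  rcases lt_or_gt_of_ne h2 with h | h
  · have := future_mulVec hg (x := -x) (by simp [hxx]) (by simpa using h)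
    rw [Matrix.mulVec_neg, hx] at this
    simp at this
    nlinarith
  · have := future_mulVec hg hxx.le h
    rw [hx] at this
    simp at this
    nlinarith

lemma exists_null_eigenvector (hg : isLorentz g) {t : ℝ} (ht : t ^ 2 ≠ 1)
    (hdet : (t • (1 : Matrix (Fin 3) (Fin 3) ℝ) - g).det = 0) :
    ∃ x : V3, x ≠ 0 ∧ mdot x x = 0 ∧ g.mulVec x = t • x := by
  obtain ⟨x, hx0, hx⟩ := Matrix.exists_mulVec_eq_zero_iff.mpr hdet
  rw [Matrix.sub_mulVec, Matrix.smul_mulVec, Matrix.one_mulVec, sub_eq_zero] at hx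
  refine ⟨x, hx0, ?_, hx.symm⟩
  have := hg x x
  rw [← hx, mdot_smul_left, mdot_smul_right] at this
  have h1 : (t ^ 2 - 1) * mdot x x = 0 := by linear_combination this
  exact (mul_eq_zero.mp h1).resolve_left (sub_ne_zero.mpr ht)

lemma three_lt_trace_of_isHyperbolic (hg : inSO21p g) (h : isHyperbolic g) : 3 < g.trace := by
  obtain ⟨a, b, c, hab, hac, hbc, hp⟩ := h
  have hdet : ∀ t : ℝ, (t • (1 : Matrix (Fin 3) (Fin 3) ℝ) - g).det =
      (t - a) * (t - b) * (t - c) := by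
    intro t
    have := congrArg (Polynomial.eval t) hp
    rw [Matrix.eval_charpoly] at this
    simpa [Matrix.smul_one_eq_diagonal] using this
  have key : ∀ t : ℝ, t ^ 2 ≠ 1 → (t • (1 : Matrix (Fin 3) (Fin 3) ℝ) - g).det = 0 →
      3 < g.trace := by
    intro t ht h0
    obtain ⟨x, hx0, hxx, hx⟩ := exists_null_eigenvector hg.1 ht h0
    have htpos := null_eigen_pos hg hx0 hxx hx
    rw [trace_of_null_eigen hg.1 hg.2.1 htpos.ne' hx0 hxx hx]
    have h1 : t ≠ 1 := by rintro rfl; simp at ht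
    have h2 : 0 < (t - 1) ^ 2 := by have := sub_ne_zero.mpr h1; positivity
    have h3 : 1 + t + t⁻¹ - 3 = (t - 1) ^ 2 * t⁻¹ := by field_simp; ring
    have := mul_pos h2 (inv_pos.mpr htpos)
    linarith
  by_cases ha : a ^ 2 = 1
  · by_cases hb : b ^ 2 = 1
    · refine key c (fun hc => ?_) (by rw [hdet]; ring)
      rw [sq_eq_one_iff] at ha hb hc
      grind
    · exact key b hb (by rw [hdet]; ring)
  · exact key a ha (by rw [hdet]; ring)

/-- The expanding null eigenvector of a hyperbolic element. -/
lemma exists_expanding (hg : inSO21p g) (hT : 3 < g.trace) :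
    ∃ (t : ℝ) (x : V3), 1 < t ∧ 0 < x 2 ∧ mdot x x = 0 ∧ g.mulVec x = t • x := by
  set r := Real.sqrt ((g.trace - 1) ^ 2 - 4) with hr
  have hr2 : r ^ 2 = (g.trace - 1) ^ 2 - 4 := Real.sq_sqrt (by nlinarith)
  have hr0 : 0 ≤ r := Real.sqrt_nonneg _
  have ht1 : 1 < (g.trace - 1 + r) / 2 := by linarith
  obtain ⟨x, hx0, hxx, hx⟩ := exists_null_eigenvector hg.1 (t := (g.trace - 1 + r) / 2)
    (by nlinarith) (by
      rw [det_smul_one_sub_lorentz hg.1 hg.2.1]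
      linear_combination ((g.trace - 1 + r) / 2 - 1) / 4 * hr2)
  rcases lt_or_gt_of_ne (null_apply_two_ne_zero hx0 hxx) with h | h
  · exact ⟨_, -x, ht1, by simpa using h, by simp [hxx], by rw [Matrix.mulVec_neg, hx, smul_neg]⟩
  · exact ⟨_, x, ht1, h, hxx, hx⟩

lemma trace_of_isParabolic (h : isParabolic g) : g.trace = 3 := by
  rw [Matrix.trace_eq_neg_charpoly_coeff, h.2]
  have : ((Polynomial.X - Polynomial.C (1 : ℝ)) ^ 3) =
      Polynomial.X ^ 3 - Polynomial.C 3 * Polynomial.X ^ 2 + Polynomial.C 3 * Polynomial.X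
        - Polynomial.C 1 := by
    simp only [map_one, map_ofNat]; ring
  rw [this]
  simp [Polynomial.coeff_X_pow, Polynomial.coeff_one]

lemma axial_ne_zero (hg : isLorentz g) (hd : g.det = 1) (hT : g.trace + 1 ≠ 0) (h1 : g ≠ 1) :
    axial g ≠ 0 := by
  intro h0
  apply h1
  rw [rodrigues hg hd hT, h0]
  have : crossMat 0 = 0 := by ext i j; fin_cases i <;> fin_cases j <;> simp [crossMat]
  simp [this]

end Lorentz

section Discrete

open Filter Topology

/-- The unipotent Lorentz matrix with null axial vector `f`. -/
def par (f : V3) : Matrix (Fin 3) (Fin 3) ℝ :=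
  1 + (1 / 2 : ℝ) • crossMat f + (1 / 8 : ℝ) • (crossMat f * crossMat f)

lemma par_conj {g : Matrix (Fin 3) (Fin 3) ℝ} (hg : isLorentz g) (hd : g.det = 1) (f : V3) :
    g * par f * ladj g = par (g.mulVec f) := by
  have h2 : g * (crossMat f * crossMat f) * ladj g =
      crossMat (g.mulVec f) * crossMat (g.mulVec f) := by
    rw [← crossMat_conj hg hd]
    calc g * (crossMat f * crossMat f) * ladj g
        = g * crossMat f * 1 * crossMat f * ladj g := by simp only [mul_assoc, one_mul]
      _ = _ := by rw [← ladj_mul_self hg]; simp only [mul_assoc]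
  simp only [par, mul_add, add_mul, mul_smul_comm, smul_mul_assoc, h2, crossMat_conj hg hd, mul_one,
    self_mul_ladj hg]

lemma eq_par_axial {g : Matrix (Fin 3) (Fin 3) ℝ} (hg : isLorentz g) (hd : g.det = 1)
    (hT : g.trace = 3) : g = par (axial g) := by
  have := rodrigues hg hd (by rw [hT]; norm_num)
  rw [hT] at this
  rw [par]
  convert this using 3
  norm_num

lemma par_zero : par 0 = 1 := by
  have : crossMat 0 = 0 := by ext i j; fin_cases i <;> fin_cases j <;> simp [crossMat]
  simp [par, this]

lemma continuous_par : Continuous par := by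
  have h : Continuous crossMat := by
    refine continuous_matrix fun i j => ?_
    fin_cases i <;> fin_cases j <;> simp [crossMat] <;> fun_prop
  unfold par
  fun_prop

/-- The identity is isolated in the subgroup `D`. -/
def oneIsolated (D : Subgroup (GL (Fin 3) ℝ)) : Prop :=
  ∀ᶠ M in 𝓝 (1 : Matrix (Fin 3) (Fin 3) ℝ), ∀ G ∈ D, (G : Matrix (Fin 3) (Fin 3) ℝ) = M → G = 1

lemma oneIsolated_of_discreteTopology {D : Subgroup (GL (Fin 3) ℝ)}
    (h : DiscreteTopology ((fun γ : GL (Fin 3) ℝ => (γ : Matrix (Fin 3) (Fin 3) ℝ)) ''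
      (D : Set (GL (Fin 3) ℝ)))) : oneIsolated D := by
  have h1 : (1 : Matrix (Fin 3) (Fin 3) ℝ) ∈
      (fun γ : GL (Fin 3) ℝ => (γ : Matrix (Fin 3) (Fin 3) ℝ)) '' (D : Set (GL (Fin 3) ℝ)) :=
    ⟨1, D.one_mem, rfl⟩
  have h2 := (discreteTopology_subtype_iff'.mp h) 1 h1
  obtain ⟨U, hU, hU1⟩ := h2
  have h1U : (1 : Matrix (Fin 3) (Fin 3) ℝ) ∈ U := by
    have : (1 : Matrix (Fin 3) (Fin 3) ℝ) ∈ U ∩ _ := hU1 ▸ Set.mem_singleton _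
    exact this.1
  filter_upwards [hU.mem_nhds h1U] with M hM G hG hGM
  have : M ∈ ({1} : Set (Matrix (Fin 3) (Fin 3) ℝ)) := by
    rw [← hU1]; exact ⟨hM, G, hG, hGM⟩
  exact Units.ext (hGM.trans this)

lemma coe_inv_eq_ladj {G : GL (Fin 3) ℝ} (hG : isLorentz (G : Matrix (Fin 3) (Fin 3) ℝ)) :
    ((G⁻¹ : GL (Fin 3) ℝ) : Matrix (Fin 3) (Fin 3) ℝ) = ladj G := by
  calc ((G⁻¹ : GL (Fin 3) ℝ) : Matrix (Fin 3) (Fin 3) ℝ)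
      = ladj G * (G : Matrix (Fin 3) (Fin 3) ℝ) * ((G⁻¹ : GL (Fin 3) ℝ) :) := by
        rw [ladj_mul_self hG, one_mul]
    _ = ladj G * ((G * G⁻¹ : GL (Fin 3) ℝ) : Matrix (Fin 3) (Fin 3) ℝ) := by
        rw [Units.val_mul, mul_assoc]
    _ = ladj G := by rw [mul_inv_cancel, Units.val_one, mul_one]

variable {D : Subgroup (GL (Fin 3) ℝ)}

lemma pow_mulVec_of_eigen {g : Matrix (Fin 3) (Fin 3) ℝ} {x : V3} {t : ℝ}
    (hx : g.mulVec x = t • x) (n : ℕ) : (g ^ n).mulVec x = t ^ n • x := by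
  induction n with
  | zero => simp
  | succ n ih => rw [pow_succ', ← Matrix.mulVec_mulVec, ih, Matrix.mulVec_smul, hx, smul_smul, pow_succ]

/-- In a discrete group, the fixed direction of a parabolic element is not contracted by any
element. -/
lemma eq_one_of_contracted (hD : oneIsolated D)
    (hso : ∀ G ∈ D, inSO21p (G : Matrix (Fin 3) (Fin 3) ℝ)) {c h : GL (Fin 3) ℝ}
    (hc : c ∈ D) (hh : h ∈ D) (hT : (c : Matrix (Fin 3) (Fin 3) ℝ).trace = 3) {t : ℝ}
    (ht : |t| < 1)
    (he : (h : Matrix (Fin 3) (Fin 3) ℝ).mulVec (axial c) = t • axial c) : c = 1 := by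
  have hconj : ∀ n : ℕ, ((h ^ n * c * (h ^ n)⁻¹ : GL (Fin 3) ℝ) : Matrix (Fin 3) (Fin 3) ℝ) =
      par (t ^ n • axial c) := by
    intro n
    have hn := hso _ (D.pow_mem hh n)
    rw [Units.val_mul, Units.val_mul, coe_inv_eq_ladj hn.1]
    nth_rw 1 [eq_par_axial (hso c hc).1 (hso c hc).2.1 hT]
    rw [par_conj hn.1 hn.2.1, Units.val_pow_eq_pow_val, pow_mulVec_of_eigen he]
  have hlim : Tendsto (fun n : ℕ => par (t ^ n • axial c)) atTop (𝓝 1) := by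
    rw [← par_zero]
    refine (continuous_par.tendsto 0).comp ?_
    have := (tendsto_pow_atTop_nhds_zero_of_abs_lt_one ht).smul_const (axial c)
    rwa [zero_smul] at this
  obtain ⟨n, hn⟩ := (hlim.eventually hD).exists
  have := hn _ (D.mul_mem (D.mul_mem (D.pow_mem hh n) hc) (D.inv_mem (D.pow_mem hh n))) (hconj n)
  rwa [mul_inv_eq_one, mul_eq_left] at this

lemma eigenvalue_eq_one_of_parabolic (hD : oneIsolated D)
    (hso : ∀ G ∈ D, inSO21p (G : Matrix (Fin 3) (Fin 3) ℝ)) {c h : GL (Fin 3) ℝ}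
    (hc : c ∈ D) (hh : h ∈ D) (hT : (c : Matrix (Fin 3) (Fin 3) ℝ).trace = 3) (hc1 : c ≠ 1)
    {t : ℝ} (ht : 0 < t)
    (he : (h : Matrix (Fin 3) (Fin 3) ℝ).mulVec (axial c) = t • axial c) : t = 1 := by
  rcases lt_trichotomy t 1 with h1 | h1 | h1
  · exact absurd (eq_one_of_contracted hD hso hc hh hT (by rwa [abs_of_pos ht]) he) hc1
  · exact h1
  · refine absurd (eq_one_of_contracted hD hso hc (D.inv_mem hh) hT (t := t⁻¹) ?_ ?_) hc1
    · rw [abs_of_pos (inv_pos.mpr ht)]; exact inv_lt_one_of_one_lt₀ h1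
    · rw [coe_inv_eq_ladj (hso h hh).1]
      exact ladj_mulVec_of_eigen (hso h hh).1 ht.ne' he

lemma coe_ne_one {G : GL (Fin 3) ℝ} (h : G ≠ 1) : (G : Matrix (Fin 3) (Fin 3) ℝ) ≠ 1 :=
  fun h' => h (Units.ext h')

/-- An element not commuting with a parabolic element moves its fixed null direction. -/
lemma mdot_axial_mulVec_neg (hD : oneIsolated D)
    (hso : ∀ G ∈ D, inSO21p (G : Matrix (Fin 3) (Fin 3) ℝ)) {c h : GL (Fin 3) ℝ}
    (hc : c ∈ D) (hh : h ∈ D) (hT : (c : Matrix (Fin 3) (Fin 3) ℝ).trace = 3)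
    (hne : c * h ≠ h * c) :
    mdot (axial c) ((h : Matrix (Fin 3) (Fin 3) ℝ).mulVec (axial c)) < 0 := by
  obtain ⟨hl, hd, -⟩ := hso c hc
  have hH := hso h hh
  have hc1 : c ≠ 1 := by rintro rfl; simp at hne
  have hf := axial_ne_zero hl hd (by rw [hT]; norm_num) (coe_ne_one hc1)
  have hff : mdot (axial c) (axial c) = 0 := by rw [mdot_axial_self hl hd, hT]; ring
  have hff' := hH.1 (axial c) (axial c)
  rw [hff] at hff'
  refine lt_of_le_of_ne (mdot_nonpos_of_null hff hff' ?_) fun h0 => ?_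
  · rcases lt_or_gt_of_ne (null_apply_two_ne_zero hf hff) with h2 | h2
    · have := future_mulVec hH (x := -axial c) (by simp [hff]) (by simpa using h2)
      rw [Matrix.mulVec_neg] at this
      simp at this
      exact mul_pos_of_neg_of_neg h2 this
    · exact mul_pos h2 (future_mulVec hH hff.le h2)
  · obtain ⟨t, ht⟩ := null_parallel hf hff hff' h0
    have htpos := null_eigen_pos hH hf hff ht
    obtain rfl := eigenvalue_eq_one_of_parabolic hD hso hc hh hT hc1 htpos ht
    apply hne
    have h1 : ((h * c * h⁻¹ : GL (Fin 3) ℝ) : Matrix (Fin 3) (Fin 3) ℝ) = c := by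
      rw [Units.val_mul, Units.val_mul, coe_inv_eq_ladj hH.1]
      conv_lhs => rw [eq_par_axial hl hd hT]
      rw [par_conj hH.1 hH.2.1, ht, one_smul]
      exact (eq_par_axial hl hd hT).symm
    have h2 : h * c * h⁻¹ = c := Units.ext h1
    exact (mul_inv_eq_iff_eq_mul.mp h2).symm

/-- Noncommuting elements of a discrete group share no null eigenvector, unless it is fixed. -/
lemma no_common_null_eigenvector (hD : oneIsolated D)
    (hso : ∀ G ∈ D, inSO21p (G : Matrix (Fin 3) (Fin 3) ℝ)) {g h : GL (Fin 3) ℝ}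
    (hg : g ∈ D) (hh : h ∈ D) (hne : g * h ≠ h * g) {x : V3} (hx0 : x ≠ 0) (hxx : mdot x x = 0)
    {s t : ℝ} (hgx : (g : Matrix (Fin 3) (Fin 3) ℝ).mulVec x = s • x)
    (hhx : (h : Matrix (Fin 3) (Fin 3) ℝ).mulVec x = t • x) : s = 1 := by
  have hG := hso g hg
  have hH := hso h hh
  have hs := null_eigen_pos hG hx0 hxx hgx
  have ht := null_eigen_pos hH hx0 hxx hhx
  have hcD : g * h * g⁻¹ * h⁻¹ ∈ D :=
    D.mul_mem (D.mul_mem (D.mul_mem hg hh) (D.inv_mem hg)) (D.inv_mem hh)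
  set c := g * h * g⁻¹ * h⁻¹ with hcdef
  have hc1 : c ≠ 1 := by
    intro h1
    rw [hcdef, mul_inv_eq_one, mul_inv_eq_iff_eq_mul] at h1
    exact hne h1
  have hC := hso c hcD
  have hcx : (c : Matrix (Fin 3) (Fin 3) ℝ).mulVec x = (1 : ℝ) • x := by
    rw [hcdef, Units.val_mul, Units.val_mul, Units.val_mul, coe_inv_eq_ladj hG.1,
      coe_inv_eq_ladj hH.1]
    simp only [← Matrix.mulVec_mulVec, ladj_mulVec_of_eigen hH.1 ht.ne' hhx, Matrix.mulVec_smul,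
      ladj_mulVec_of_eigen hG.1 hs.ne' hgx, hhx, hgx, smul_smul]
    congr 1
    field_simp
  have hT : (c : Matrix (Fin 3) (Fin 3) ℝ).trace = 3 := by
    rw [trace_of_null_eigen hC.1 hC.2.1 one_ne_zero hx0 hxx hcx]; norm_num
  have hf := axial_ne_zero hC.1 hC.2.1 (by rw [hT]; norm_num) (coe_ne_one hc1)
  obtain ⟨r, hr⟩ := exists_smul_of_lcross_eq_zero hf
    (b := x) (by rw [lcross_axial_of_eigen hC.1 one_ne_zero hcx]; simp)
  have hr0 : r ≠ 0 := by rintro rfl; simp at hr; exact hx0 hr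
  refine eigenvalue_eq_one_of_parabolic hD hso hcD hg hT hc1 hs ?_
  rw [hr, Matrix.mulVec_smul, smul_comm s r] at hgx
  exact smul_right_injective _ hr0 hgx

end Discrete

section Affine

open Filter

/-- `γ` is the affine map `x ↦ g x + u`. -/
def isAff (γ : Equiv.Perm V3) (g : Matrix (Fin 3) (Fin 3) ℝ) (u : V3) : Prop :=
  ∀ x, γ x = g.mulVec x + u

lemma isAff.mul {γ η : Equiv.Perm V3} {g h : Matrix (Fin 3) (Fin 3) ℝ} {u w : V3}
    (hγ : isAff γ g u) (hη : isAff η h w) : isAff (γ * η) (g * h) (g.mulVec w + u) := by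
  intro x
  rw [Equiv.Perm.mul_apply, hη, hγ, Matrix.mulVec_add, Matrix.mulVec_mulVec, add_assoc]

lemma isAff.linear_eq {γ : Equiv.Perm V3} {g h : Matrix (Fin 3) (Fin 3) ℝ} {u w : V3}
    (hγ : isAff γ g u) (hη : isAff γ h w) : g = h := by
  have h0 : u = w := by have := (hγ 0).symm.trans (hη 0); simpa using this
  apply Matrix.mulVec_injective
  funext x
  have := (hγ x).symm.trans (hη x)
  rwa [h0, add_left_inj] at this

lemma isAff.pow {γ : Equiv.Perm V3} {g : Matrix (Fin 3) (Fin 3) ℝ} {u : V3}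
    (hγ : isAff γ g u) (n : ℕ) : ∃ w, isAff (γ ^ n) (g ^ n) w := by
  induction n with
  | zero => exact ⟨0, fun x => by simp⟩
  | succ n ih =>
    obtain ⟨w, hw⟩ := ih
    exact ⟨_, by rw [pow_succ', pow_succ']; exact hγ.mul hw⟩

lemma par_mulVec {f : V3} (hf : mdot f f = 0) (x : V3) :
    (par f).mulVec x = x + (1 / 2 : ℝ) • lcross f x - (1 / 8 * mdot f x) • f := by
  simp only [par, Matrix.add_mulVec, Matrix.one_mulVec, Matrix.smul_mulVec,
    ← Matrix.mulVec_mulVec, crossMat_mulVec, lcross_lcross, hf]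
  module

lemma axial_par (f : V3) : axial (par f) = f := by
  have h1 : axial 1 = 0 := by ext i; fin_cases i <;> simp [axial]
  have h2 := axial_crossMat_mul f 1
  have h3 := axial_crossMat_sq_mul f 1
  have h4 : ladj 1 = 1 := by ext i j; fin_cases i <;> fin_cases j <;> simp [ladj]
  rw [mul_one, Matrix.one_mulVec, Matrix.trace_one] at h2
  rw [mul_one, h1, h4, Matrix.one_mulVec, lcross_self] at h3
  rw [par, axial_add, axial_add, axial_smul, axial_smul, h1, h2, h3]
  simp only [Fintype.card_fin]
  module

/-- Iterates of an affine map with unipotent linear part. -/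
lemma pow_apply_par {γ : Equiv.Perm V3} {f u : V3} (hf : mdot f f = 0) (hγ : isAff γ (par f) u)
    (n : ℕ) : isAff (γ ^ n) (par ((n : ℝ) • f))
      ((n : ℝ) • u + ((n : ℝ) * (n - 1) / 4) • lcross f u -
        (((n : ℝ) - 1) * n * (2 * n - 1) / 48 * mdot f u) • f) := by
  have hff : ∀ t : ℝ, mdot (t • f) (t • f) = 0 := fun t => by simp [hf]
  induction n with
  | zero => intro x; simp [par_zero]
  | succ n ih =>
    intro x
    rw [pow_succ', Equiv.Perm.mul_apply, ih, hγ, par_mulVec hf, par_mulVec (hff _),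
      par_mulVec (hff _)]
    simp only [lcross_add_right, lcross_sub_right, lcross_smul_right, lcross_smul_left,
      lcross_lcross, lcross_self, mdot_add_right, mdot_sub_right, mdot_smul_right, mdot_smul_left,
      mdot_lcross_self_left, hf]
    push_cast
    match_scalars <;> ring

lemma pow_eq_par {c : GL (Fin 3) ℝ} {f : V3} (hf : mdot f f = 0)
    (hc : (c : Matrix (Fin 3) (Fin 3) ℝ) = par f) (n : ℕ) :
    ((c ^ n : GL (Fin 3) ℝ) : Matrix (Fin 3) (Fin 3) ℝ) = par ((n : ℝ) • f) := by
  have hff : ∀ t : ℝ, mdot (t • f) (t • f) = 0 := fun t => by simp [hf]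
  induction n with
  | zero => simp [par_zero]
  | succ n ih =>
    rw [pow_succ', Units.val_mul, ih, hc]
    apply Matrix.mulVec_injective
    funext x
    simp only [← Matrix.mulVec_mulVec]
    rw [par_mulVec hf, par_mulVec (hff _), par_mulVec (hff _)]
    simp only [lcross_add_right, lcross_sub_right, lcross_smul_right, lcross_smul_left,
      lcross_lcross, lcross_self, mdot_add_right, mdot_sub_right, mdot_smul_right, mdot_smul_left,
      mdot_lcross_self_left, hf]
    push_cast
    match_scalars <;> ring

lemma eventually_quartic_pos {a b c d e : ℝ} (ha : 0 < a) :
    ∀ᶠ n : ℕ in atTop, 0 < a * (n : ℝ) ^ 4 + b * (n : ℝ) ^ 3 + c * (n : ℝ) ^ 2 + d * n + e := by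
  have h1 := tendsto_natCast_atTop_atTop (R := ℝ)
  filter_upwards [h1.eventually_gt_atTop ((|b| + |c| + |d| + |e|) / a), h1.eventually_ge_atTop 1]
    with n hn hn1
  rw [div_lt_iff₀ ha] at hn
  set x : ℝ := (n : ℝ)
  have p1 : x ≤ x ^ 3 := le_self_pow₀ hn1 (by norm_num)
  have p2 : x ^ 2 ≤ x ^ 3 := pow_le_pow_right₀ hn1 (by norm_num)
  have p3 : 1 ≤ x ^ 3 := one_le_pow₀ hn1
  have q3 : -(|b| * x ^ 3) ≤ b * x ^ 3 := by nlinarith [neg_abs_le b]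
  have q2 : -(|c| * x ^ 3) ≤ c * x ^ 2 := by nlinarith [neg_abs_le c, abs_nonneg c, sq_nonneg x]
  have q1 : -(|d| * x ^ 3) ≤ d * x := by nlinarith [neg_abs_le d, abs_nonneg d]
  have q0 : -(|e| * x ^ 3) ≤ e := by nlinarith [neg_abs_le e, abs_nonneg e]
  have : 0 < (x * a - (|b| + |c| + |d| + |e|)) * x ^ 3 := mul_pos (by linarith) (by linarith)
  nlinarith

lemma axial_par_mul {f : V3} (hf : mdot f f = 0) (h : Matrix (Fin 3) (Fin 3) ℝ) (t : ℝ) :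
    axial (par (t • f) * h) = axial h + (t / 2) • (h.trace • f - h.mulVec f) -
      (t ^ 2 / 8) • lcross f ((ladj h).mulVec f) := by
  have hc : crossMat (t • f) = t • crossMat f := by
    ext i j; fin_cases i <;> fin_cases j <;> simp [crossMat]
  have : par (t • f) * h = h + (t / 2) • (crossMat f * h) +
      (t ^ 2 / 8) • (crossMat f * crossMat f * h) := by
    rw [par, hc]
    simp only [add_mul, smul_mul_assoc, mul_smul_comm, one_mul]
    module
  rw [this, axial_add, axial_add, axial_smul, axial_smul, axial_crossMat_mul,
    axial_crossMat_sq_mul, hf]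
  module

lemma trace_par_mul {f : V3} (hf : mdot f f = 0) (h : Matrix (Fin 3) (Fin 3) ℝ) (t : ℝ) :
    (par (t • f) * h).trace = h.trace + t / 2 * (crossMat f * h).trace -
      t ^ 2 / 8 * mdot f (h.mulVec f) := by
  have hc : crossMat (t • f) = t • crossMat f := by
    ext i j; fin_cases i <;> fin_cases j <;> simp [crossMat]
  have : par (t • f) * h = h + (t / 2) • (crossMat f * h) +
      (t ^ 2 / 8) • (crossMat f * crossMat f * h) := by
    rw [par, hc]
    simp only [add_mul, smul_mul_assoc, mul_smul_comm, one_mul]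
    module
  rw [this, Matrix.trace_add, Matrix.trace_add, Matrix.trace_smul, Matrix.trace_smul,
    trace_crossMat_sq_mul, hf]
  simp only [smul_eq_mul]
  ring

/-- The unnormalized Margulis invariant of `γⁿη`, for `γ` with unipotent linear part, is a
polynomial of degree four in `n`. -/
lemma margulis_par_pow_mul {f : V3} (hf : mdot f f = 0) (h : Matrix (Fin 3) (Fin 3) ℝ)
    (u w : V3) : ∃ b c d e : ℝ, ∀ n : ℝ,
      mdot ((par (n • f)).mulVec w + (n • u + (n * (n - 1) / 4) • lcross f u -
        ((n - 1) * n * (2 * n - 1) / 48 * mdot f u) • f)) (axial (par (n • f) * h)) =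
      -(mdot u f * mdot f (h.mulVec f) / 96) * n ^ 4 + b * n ^ 3 + c * n ^ 2 + d * n + e := by
  set a3 : V3 := (-(mdot f u / 24)) • f
  set a2 : V3 := (1 / 4 : ℝ) • lcross f u + (mdot f u / 16) • f - (mdot f w / 8) • f
  set a1 : V3 := u - (1 / 4 : ℝ) • lcross f u - (mdot f u / 48) • f + (1 / 2 : ℝ) • lcross f w
  set b2 : V3 := (-(1 / 8 : ℝ)) • lcross f ((ladj h).mulVec f)
  set b1 : V3 := (1 / 2 : ℝ) • (h.trace • f - h.mulVec f)
  have hA : ∀ n : ℝ, (par (n • f)).mulVec w + (n • u + (n * (n - 1) / 4) • lcross f u -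
        ((n - 1) * n * (2 * n - 1) / 48 * mdot f u) • f) =
      n ^ 3 • a3 + n ^ 2 • a2 + n • a1 + w := by
    intro n
    rw [par_mulVec (by simp [hf])]
    simp only [a3, a2, a1, lcross_smul_left, mdot_smul_left]
    module
  have hB : ∀ n : ℝ, axial (par (n • f) * h) = n ^ 2 • b2 + n • b1 + axial h := by
    intro n
    rw [axial_par_mul hf]
    simp only [b2, b1]
    module
  have h5 : mdot a3 b2 = 0 := by simp [a3, b2]
  have hk : mdot f ((ladj h).mulVec f) = mdot f (h.mulVec f) := by
    rw [← mdot_mulVec_left, mdot_comm]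
  have h4 : mdot a3 b1 + mdot a2 b2 = -(mdot u f * mdot f (h.mulVec f) / 96) := by
    simp only [a3, a2, b1, b2, mdot_smul_left, mdot_smul_right, mdot_add_left, mdot_sub_left,
      mdot_sub_right, mdot_lcross_self_left, mdot_lcross_lcross, hf, hk, mdot_comm u f]
    ring
  refine ⟨mdot a3 (axial h) + mdot a2 b1 + mdot a1 b2, mdot a2 (axial h) + mdot a1 b1 + mdot w b2,
    mdot a1 (axial h) + mdot w b1, mdot w (axial h), fun n => ?_⟩
  rw [hA, hB]
  simp only [mdot_add_left, mdot_add_right, mdot_smul_left, mdot_smul_right]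
  linear_combination n ^ 5 * h5 + n ^ 4 * h4

/-- Multiplying a high power of a parabolic transformation by a transformation with which it does
not commute gives a hyperbolic transformation of the same sign. -/
lemma exists_hyperbolic_same_sign {D : Subgroup (GL (Fin 3) ℝ)} {Γ : Subgroup (Equiv.Perm V3)}
    (hD : oneIsolated D) (hso : ∀ G ∈ D, inSO21p (G : Matrix (Fin 3) (Fin 3) ℝ))
    {g h : GL (Fin 3) ℝ} (hg : g ∈ D) (hh : h ∈ D) (hne : g * h ≠ h * g)
    (hT : 3 ≤ (g : Matrix (Fin 3) (Fin 3) ℝ).trace)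
    {γ η : Equiv.Perm V3} {u w : V3} (hγΓ : γ ∈ Γ) (hηΓ : η ∈ Γ)
    (hγ : isAff γ g u) (hη : isAff η h w) (hα : mdot u (axial g) ≠ 0) :
    ∃ g' ∈ D, ∃ γ' ∈ Γ, ∃ u', isAff γ' g' u' ∧
      3 < (g' : Matrix (Fin 3) (Fin 3) ℝ).trace ∧ g' * h ≠ h * g' ∧
      0 < mdot u (axial g) * mdot u' (axial g') := by
  rcases hT.lt_or_eq with hT | hT
  · exact ⟨g, hg, γ, hγΓ, u, hγ, hT, hne, mul_self_pos.mpr hα⟩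
  have hl := (hso g hg).1
  have hd := (hso g hg).2.1
  have hneg := mdot_axial_mulVec_neg hD hso hg hh hT.symm hne
  have hpar := eq_par_axial hl hd hT.symm
  have hff : mdot (axial g) (axial g) = 0 := by rw [mdot_axial_self hl hd, ← hT]; ring
  set f := axial (g : Matrix (Fin 3) (Fin 3) ℝ)
  obtain ⟨b, c, d, e, hpoly⟩ := margulis_par_pow_mul hff h u w
  set s := mdot f ((h : Matrix (Fin 3) (Fin 3) ℝ).mulVec f)
  have hlead : 0 < mdot u f * -(mdot u f * s / 96) := by
    have : 0 < mdot u f ^ 2 := by positivity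
    nlinarith
  have E1 := eventually_quartic_pos (b := mdot u f * b) (c := mdot u f * c) (d := mdot u f * d)
    (e := mdot u f * e) hlead
  have E2 := eventually_quartic_pos (a := -s / 8)
    (b := (crossMat f * (h : Matrix (Fin 3) (Fin 3) ℝ)).trace / 2)
    (c := (h : Matrix (Fin 3) (Fin 3) ℝ).trace - 3) (d := 0) (e := 0) (by linarith)
  obtain ⟨n, h1, h2, hn⟩ := (E1.and (E2.and (eventually_ge_atTop 1))).exists
  have hn0 : (0 : ℝ) < n := by exact_mod_cast hn
  have hpow := pow_eq_par hff hpar n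
  rw [hpar] at hγ
  refine ⟨g ^ n * h, D.mul_mem (D.pow_mem hg n) hh, γ ^ n * η, Γ.mul_mem (Γ.pow_mem hγΓ n) hηΓ,
    (par ((n : ℝ) • f)).mulVec w + ((n : ℝ) • u + ((n : ℝ) * (n - 1) / 4) • lcross f u -
      (((n : ℝ) - 1) * n * (2 * n - 1) / 48 * mdot f u) • f), ?_, ?_, ?_, ?_⟩
  · rw [Units.val_mul, hpow]
    exact (pow_apply_par hff hγ n).mul hη
  · rw [Units.val_mul, hpow, trace_par_mul hff]
    have h3 : 0 < (n : ℝ) ^ 2 * ((h : Matrix (Fin 3) (Fin 3) ℝ).trace +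
        n / 2 * (crossMat f * (h : Matrix (Fin 3) (Fin 3) ℝ)).trace - n ^ 2 / 8 * s - 3) := by
      convert h2 using 1; ring
    have := pos_of_mul_pos_right h3 (by positivity)
    linarith
  · intro hcomm
    rw [← mul_assoc, mul_left_inj] at hcomm
    have hH := hso h hh
    have h3 : par ((n : ℝ) • f) = par ((h : Matrix (Fin 3) (Fin 3) ℝ).mulVec ((n : ℝ) • f)) := by
      rw [← par_conj hH.1 hH.2.1, ← hpow, ← Units.val_mul, ← hcomm, Units.val_mul, mul_assoc,
        self_mul_ladj hH.1, mul_one]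
    have h4 := congrArg axial h3
    rw [axial_par, axial_par, Matrix.mulVec_smul] at h4
    have h5 := smul_right_injective _ hn0.ne' h4
    simp only [s, ← h5, hff] at hneg
    exact lt_irrefl _ hneg
  · rw [Units.val_mul, hpow, hpoly]
    linarith

end Affine

section OppositeSigns

/-- Two null vectors which are not orthogonal, together with their cross product, span. -/
lemma exists_frame_expansion {x y : V3} (hxx : mdot x x = 0) (hyy : mdot y y = 0)
    (hxy : mdot x y ≠ 0) (z : V3) : ∃ p q r : ℝ, z = p • lcross y x + q • x + r • y := by
  have h := cramer_expansion (lcross y x) y x z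
  rw [mdot_lcross_lcross, mdot_comm y x, hxx, hyy, mul_zero, sub_zero] at h
  have hk : mdot x y * mdot x y ≠ 0 := mul_ne_zero hxy hxy
  refine ⟨(mdot x y * mdot x y)⁻¹ * mdot z (lcross y x),
    (mdot x y * mdot x y)⁻¹ * mdot z (lcross (lcross y x) y),
    (mdot x y * mdot x y)⁻¹ * mdot z (lcross x (lcross y x)), ?_⟩
  refine ((eq_inv_smul_iff₀ hk).mpr h).trans ?_
  module

/-- The axial vector lies in the plane spanned by a null eigenvector and the cross product. -/
lemma exists_axial_expansion {f x y : V3} {k : ℝ} (hk : k ≠ 0) (hxx : mdot x x = 0)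
    (hyy : mdot y y = 0) (hxy : mdot x y ≠ 0) (hf : lcross f x = k • x) :
    ∃ e : ℝ, f = (-(k / mdot x y)) • lcross y x + e • x := by
  obtain ⟨p, q, r, hpqr⟩ := exists_frame_expansion hxx hyy hxy f
  have hx0 : x ≠ 0 := by rintro rfl; simp at hxy
  have h1 : mdot f x = 0 := by
    have := mdot_lcross_self_left f x
    rw [hf, mdot_smul_right] at this
    exact (mul_eq_zero.mp this).resolve_left hk
  have hr : r = 0 := by
    rw [hpqr] at h1
    simp only [mdot_add_left, mdot_smul_left, hxx, mdot_comm (lcross y x) x,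
      mdot_lcross_self_right, mdot_comm y x] at h1
    simpa [hxy] using h1
  have h2 : lcross (lcross y x) x = -mdot x y • x := by
    have : lcross (lcross y x) x = -lcross x (lcross y x) := by
      ext i; fin_cases i <;> simp [lcross] <;> ring
    rw [this, lcross_lcross, hxx]; module
  rw [hr, zero_smul, add_zero] at hpqr
  have h3 : p * -mdot x y = k := by
    rw [hpqr, lcross_add_left, lcross_smul_left, lcross_smul_left, lcross_self, h2, smul_zero,
      add_zero, smul_smul] at hf
    exact smul_left_injective ℝ hx0 hf
  refine ⟨q, ?_⟩
  rw [← h3]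
  have : -(p * -mdot x y / mdot x y) = p := by field_simp
  rw [this]
  exact hpqr

lemma pow_apply_translate {γ : Equiv.Perm V3} {g : Matrix (Fin 3) (Fin 3) ℝ} {u f x o : V3}
    {a b : ℝ} (hγ : isAff γ g u) (hgx : g.mulVec x = b • x) (hgf : g.mulVec f = f)
    (ho : g.mulVec o + u = o + a • f) (n : ℕ) (s c : ℝ) :
    (γ ^ n) (o + s • f + c • x) = o + (n * a + s) • f + (b ^ n * c) • x := by
  induction n with
  | zero => simp
  | succ n ih =>
    rw [pow_succ', Equiv.Perm.mul_apply, ih, hγ]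
    simp only [Matrix.mulVec_add, Matrix.mulVec_smul, hgx, hgf]
    have : g.mulVec o = o + a • f - u := by rw [← ho]; abel
    rw [this]
    push_cast
    match_scalars <;> ring

lemma exists_bound_succ_mul_pow {r : ℝ} (h0 : 0 < r) (h1 : r < 1) :
    ∃ C : ℝ, 0 ≤ C ∧ ∀ n : ℕ, ((n : ℝ) + 1) * r ^ n ≤ C := by
  obtain ⟨C, hC⟩ := (tendsto_self_mul_const_pow_of_lt_one h0.le h1).bddAbove_range
  have hC0 : 0 ≤ C := by have := hC ⟨0, rfl⟩; simpa using this
  refine ⟨C + 1, by linarith, fun n => ?_⟩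
  have h2 : (n : ℝ) * r ^ n ≤ C := hC ⟨n, rfl⟩
  have h3 : r ^ n ≤ 1 := pow_le_one₀ h0.le h1.le
  linarith

/-- Elements `ηᵐγⁿ` moving a fixed compact set to meet itself, when `γ` and `η` translate in
opposite directions along their axes. -/
lemma exists_compact_returning {γ η : Equiv.Perm V3} {g h : Matrix (Fin 3) (Fin 3) ℝ}
    {u w f f' x y z o o' : V3} {a a' b r l l' e e' q0 q1 q2 : ℝ}
    (hγ : isAff γ g u) (hη : isAff η h w) (hgx : g.mulVec x = b • x) (hhy : h.mulVec y = r • y)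
    (hgf : g.mulVec f = f) (hhf : h.mulVec f' = f') (ho : g.mulVec o + u = o + a • f)
    (ho' : h.mulVec o' + w = o' + a' • f') (ha : 0 < a) (ha' : a' < 0) (hb : 1 < b)
    (hr0 : 0 < r) (hr1 : r < 1) (hl : 0 < l) (hl' : 0 < l') (hf : f = l • z + e • x)
    (hf' : f' = l' • z + e' • y) (hq : o' - o = q0 • z + q1 • x + q2 • y) :
    ∃ K : Set V3, IsCompact K ∧ ∀ m : ℕ, ∃ n : ℕ, ∃ P ∈ K, (η ^ m * γ ^ n) P ∈ K := by
  obtain ⟨C, hC0, hC⟩ := exists_bound_succ_mul_pow (inv_pos.mpr (zero_lt_one.trans hb))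
    (inv_lt_one_of_one_lt₀ hb)
  obtain ⟨C', hC0', hC'⟩ := exists_bound_succ_mul_pow hr0 hr1
  set S := |q0 / l| + a with hS
  set T := |q1| * C + (|q0 / l| + a) * |e| * C with hT
  set T' := (|a'| * |e'| + |q2|) * C' with hT'
  refine ⟨Metric.closedBall 0 (‖o‖ + S * ‖f‖ + T * ‖x‖ + (‖o'‖ + T' * ‖y‖)),
    isCompact_closedBall _ _, fun m => ?_⟩
  have hS0 : 0 ≤ S := by positivity
  have hT0 : 0 ≤ T := by positivity
  have hT0' : 0 ≤ T' := by positivity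
  set k : ℝ := m * (-a' * l') / (l * a) with hk
  have hk0 : 0 ≤ k := by
    have : 0 ≤ -a' := by linarith
    positivity
  set n := ⌊k⌋₊
  have hn1 : (n : ℝ) ≤ k := Nat.floor_le hk0
  have hn2 : k < n + 1 := Nat.lt_floor_add_one k
  have hka : k * a * l = m * (-a' * l') := by rw [hk]; field_simp
  set s := q0 / l + (k - n) * a with hs
  set c := (q1 - (q0 / l + k * a) * e) * b⁻¹ ^ n with hc
  set c' := (m * a' * e' - q2) * r ^ m with hc'
  have hsS : |s| ≤ S := by
    refine (abs_add_le _ _).trans ?_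
    have h1 : |(k - n) * a| ≤ a := by
      rw [abs_of_nonneg (mul_nonneg (by linarith) ha.le)]
      nlinarith
    linarith
  have hbn : 0 < b⁻¹ ^ n := pow_pos (inv_pos.mpr (zero_lt_one.trans hb)) n
  have hn0 : (0 : ℝ) ≤ n := Nat.cast_nonneg n
  have hm0 : (0 : ℝ) ≤ m := Nat.cast_nonneg m
  have hcT : |c| ≤ T := by
    have h1 : |q1 - (q0 / l + k * a) * e| ≤ (|q1| + (|q0 / l| + a) * |e|) * (n + 1) := by
      refine (abs_sub _ _).trans ?_
      have h2 : |q0 / l + k * a| ≤ (|q0 / l| + a) * (n + 1) := by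
        refine (abs_add_le _ _).trans ?_
        rw [abs_of_nonneg (mul_nonneg hk0 ha.le)]
        nlinarith [mul_nonneg (abs_nonneg (q0 / l)) hn0]
      rw [abs_mul]
      nlinarith [mul_le_mul_of_nonneg_right h2 (abs_nonneg e), mul_nonneg (abs_nonneg q1) hn0]
    rw [hc, abs_mul, abs_of_pos hbn]
    calc _ ≤ (|q1| + (|q0 / l| + a) * |e|) * (n + 1) * b⁻¹ ^ n := by gcongr
      _ = (|q1| + (|q0 / l| + a) * |e|) * ((n + 1) * b⁻¹ ^ n) := by ring
      _ ≤ (|q1| + (|q0 / l| + a) * |e|) * C := by gcongr; exact hC n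
      _ = T := by rw [hT]; ring
  have hcT' : |c'| ≤ T' := by
    have h1 : |m * a' * e' - q2| ≤ (|a'| * |e'| + |q2|) * (m + 1) := by
      refine (abs_sub _ _).trans ?_
      rw [abs_mul, abs_mul, abs_of_nonneg hm0]
      nlinarith [mul_nonneg (abs_nonneg q2) hm0, mul_nonneg (abs_nonneg a') (abs_nonneg e')]
    rw [hc', abs_mul, abs_of_pos (pow_pos hr0 m)]
    calc _ ≤ (|a'| * |e'| + |q2|) * (m + 1) * r ^ m := by gcongr
      _ = (|a'| * |e'| + |q2|) * ((m + 1) * r ^ m) := by ring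
      _ ≤ T' := by rw [hT']; gcongr; exact hC' m
  have hmid : o + (n * a + s) • f + (b ^ n * c) • x =
      o' + (-(m * a')) • f' + (m * a' * e' - q2) • y := by
    have hb1 : b ^ n * c = q1 - (q0 / l + k * a) * e := by
      rw [hc, inv_pow]
      have : b ^ n ≠ 0 := pow_ne_zero _ (by linarith)
      field_simp
    have hs1 : n * a + s = q0 / l + k * a := by rw [hs]; ring
    have ho1 : o' = o + (q0 • z + q1 • x + q2 • y) := by rw [← hq]; abel
    have hz : (q0 / l + k * a) * l = q0 + -(m * a') * l' := by
      rw [add_mul, hka]; field_simp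
    rw [hb1, hs1, ho1, hf, hf', smul_add, smul_smul, hz]
    module
  refine ⟨n, o + s • f + c • x, ?_, ?_⟩
  · rw [mem_closedBall_zero_iff]
    have h1 : ‖o + s • f + c • x‖ ≤ ‖o‖ + S * ‖f‖ + T * ‖x‖ := by
      refine (norm_add₃_le).trans ?_
      rw [norm_smul, norm_smul, Real.norm_eq_abs, Real.norm_eq_abs]
      gcongr
    have : 0 ≤ ‖o'‖ + T' * ‖y‖ := by positivity
    linarith
  · rw [Equiv.Perm.mul_apply, pow_apply_translate hγ hgx hgf ho, hmid,
      pow_apply_translate hη hhy hhf ho', mem_closedBall_zero_iff]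
    have h1 : ‖o' + (m * a' + -(m * a')) • f' + (r ^ m * (m * a' * e' - q2)) • y‖ ≤
        ‖o'‖ + T' * ‖y‖ := by
      rw [add_neg_cancel, zero_smul, add_zero, mul_comm (r ^ m)]
      refine (norm_add_le _ _).trans ?_
      rw [norm_smul, Real.norm_eq_abs]
      gcongr
    have : 0 ≤ ‖o‖ + S * ‖f‖ + T * ‖x‖ := by positivity
    linarith

end OppositeSigns

section Signs

variable {D : Subgroup (GL (Fin 3) ℝ)} {Γ : Subgroup (Equiv.Perm V3)}

lemma pow_mul_pow_injective (hD : oneIsolated D)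
    (hso : ∀ G ∈ D, inSO21p (G : Matrix (Fin 3) (Fin 3) ℝ)) {g h : GL (Fin 3) ℝ}
    (hg : g ∈ D) (hh : h ∈ D) (hne : g * h ≠ h * g) {γ η : Equiv.Perm V3} {u w y : V3} {r : ℝ}
    (hγ : isAff γ g u) (hη : isAff η h w) (hy0 : y ≠ 0) (hyy : mdot y y = 0) (hr0 : 0 < r)
    (hr1 : r < 1) (hhy : (h : Matrix (Fin 3) (Fin 3) ℝ).mulVec y = r • y) (n : ℕ → ℕ) :
    Function.Injective fun m => η ^ m * γ ^ n m := by
  have key : ∀ m j : ℕ, η ^ m * γ ^ n m ≠ η ^ (m + (j + 1)) * γ ^ n (m + (j + 1)) := by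
    intro m j heq
    rw [pow_add, mul_assoc, mul_right_inj, ← mul_inv_eq_iff_eq_mul] at heq
    have hcomm : η ^ (j + 1) * γ = γ * η ^ (j + 1) := by
      rw [← heq]
      exact (((Commute.refl γ).pow_left _).mul_left ((Commute.refl γ).pow_left _).inv_left).eq
    obtain ⟨v, hv⟩ := hη.pow (j + 1)
    have hl := (hv.mul hγ).linear_eq (hcomm ▸ hγ.mul hv)
    have h1 := pow_mulVec_of_eigen hhy (j + 1)
    set H := (h : Matrix (Fin 3) (Fin 3) ℝ) ^ (j + 1) with hH
    have h2 : H.mulVec ((g : Matrix (Fin 3) (Fin 3) ℝ).mulVec y) =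
        r ^ (j + 1) • (g : Matrix (Fin 3) (Fin 3) ℝ).mulVec y := by
      rw [Matrix.mulVec_mulVec, hl, ← Matrix.mulVec_mulVec, h1, Matrix.mulVec_smul]
    have hHl : isLorentz H := by
      have := (hso _ (D.pow_mem hh (j + 1))).1
      rwa [Units.val_pow_eq_pow_val] at this
    have h3 := hHl y ((g : Matrix (Fin 3) (Fin 3) ℝ).mulVec y)
    rw [h1, h2, mdot_smul_left, mdot_smul_right] at h3
    have hr : r ^ (j + 1) < 1 := pow_lt_one₀ hr0.le hr1 (Nat.succ_ne_zero j)
    have hrp : 0 < r ^ (j + 1) := pow_pos hr0 _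
    have h4 : (r ^ (j + 1) * r ^ (j + 1) - 1) *
        mdot y ((g : Matrix (Fin 3) (Fin 3) ℝ).mulVec y) = 0 := by linear_combination h3
    have h5 := (mul_eq_zero.mp h4).resolve_left (by nlinarith)
    obtain ⟨t, ht⟩ := null_parallel hy0 hyy (((hso g hg).1 y y).trans hyy) h5
    exact hr1.ne (no_common_null_eigenvector hD hso hh hg hne.symm hy0 hyy hhy ht)
  intro m m' heq
  rcases lt_trichotomy m m' with hlt | rfl | hlt
  · obtain ⟨j, rfl⟩ := Nat.exists_eq_add_of_lt hlt
    exact absurd heq (key m j)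
  · rfl
  · obtain ⟨j, rfl⟩ := Nat.exists_eq_add_of_lt hlt
    exact absurd heq.symm (key m' j)

lemma exists_axis_point {g : Matrix (Fin 3) (Fin 3) ℝ} {u : V3}
    (hg : inSO21p g) (hT : 3 < g.trace) :
    ∃ o, g.mulVec o + u = o + (mdot u (axial g) / mdot (axial g) (axial g)) • axial g := by
  have hff : 0 < mdot (axial g) (axial g) := by
    rw [mdot_axial_self hg.1 hg.2.1]; exact mul_pos (by linarith) (by linarith)
  have hf0 : axial g ≠ 0 := by intro h0; simp [h0] at hff
  obtain ⟨o, ho⟩ := exists_mulVec_sub_eq hg.1 hg.2.1 (by linarith) hf0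
    (z := (mdot u (axial g) / mdot (axial g) (axial g)) • axial g - u)
    (by rw [mdot_sub_left, mdot_smul_left, div_mul_cancel₀ _ hff.ne', sub_self])
  exact ⟨o, by rw [sub_eq_iff_eq_add] at ho; rw [ho]; abel⟩

/-- Non-commuting hyperbolic elements of a properly discontinuous group do not have opposite
signs. -/
lemma not_opposite_signs (hD : oneIsolated D)
    (hso : ∀ G ∈ D, inSO21p (G : Matrix (Fin 3) (Fin 3) ℝ)) (hΓ : properlyDisc Γ)
    {g h : GL (Fin 3) ℝ} (hg : g ∈ D) (hh : h ∈ D) (hne : g * h ≠ h * g)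
    (hTg : 3 < (g : Matrix (Fin 3) (Fin 3) ℝ).trace)
    (hTh : 3 < (h : Matrix (Fin 3) (Fin 3) ℝ).trace)
    {γ η : Equiv.Perm V3} {u w : V3} (hγΓ : γ ∈ Γ) (hηΓ : η ∈ Γ)
    (hγ : isAff γ g u) (hη : isAff η h w) (hpos : 0 < mdot u (axial g)) :
    ¬ mdot w (axial h) < 0 := by
  intro hneg
  have hG := hso g hg
  have hH := hso h hh
  obtain ⟨b, x, hb, hx2, hxx, hgx⟩ := exists_expanding hG hTg
  obtain ⟨b', y, hb', hy2, hyy, hly⟩ := exists_expanding (inSO21p_ladj hH) (by rwa [trace_ladj])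
  have hx0 : x ≠ 0 := by rintro rfl; simp at hx2
  have hy0 : y ≠ 0 := by rintro rfl; simp at hy2
  have hhy : (h : Matrix (Fin 3) (Fin 3) ℝ).mulVec y = b'⁻¹ • y := by
    have := ladj_mulVec_of_eigen (isLorentz_ladj hH.1) (by linarith) hly
    rwa [ladj_ladj] at this
  have hr0 : 0 < b'⁻¹ := inv_pos.mpr (by linarith)
  have hr1 : b'⁻¹ < 1 := inv_lt_one_of_one_lt₀ hb'
  have hxy0 : mdot x y ≠ 0 := by
    intro h0
    obtain ⟨t, rfl⟩ := null_parallel hx0 hxx hyy h0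
    have ht : t ≠ 0 := by rintro rfl; simp at hy0
    have hhx : (h : Matrix (Fin 3) (Fin 3) ℝ).mulVec x = b'⁻¹ • x := by
      rw [Matrix.mulVec_smul, smul_comm] at hhy
      exact smul_right_injective _ ht hhy
    exact hb.ne' (no_common_null_eigenvector hD hso hg hh hne hx0 hxx hgx hhx)
  have hxy : mdot x y < 0 := lt_of_le_of_ne (mdot_nonpos_of_null hxx hyy (mul_pos hx2 hy2)) hxy0
  have hk : 0 < b - b⁻¹ := sub_pos.mpr ((inv_lt_one_of_one_lt₀ hb).trans hb)
  have hk' : b'⁻¹ - b'⁻¹⁻¹ < 0 := by rw [inv_inv]; linarith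
  obtain ⟨e, he⟩ := exists_axial_expansion hk.ne' hxx hyy hxy0
    (lcross_axial_of_eigen hG.1 (by linarith) hgx)
  obtain ⟨e', he'⟩ := exists_axial_expansion hk'.ne hyy hxx (by rwa [mdot_comm])
    (lcross_axial_of_eigen hH.1 hr0.ne' hhy)
  obtain ⟨o, ho⟩ := exists_axis_point (u := u) hG hTg
  obtain ⟨o', ho'⟩ := exists_axis_point (u := w) hH hTh
  obtain ⟨q0, q1, q2, hq⟩ := exists_frame_expansion hxx hyy hxy0 (o' - o)
  have hanti : lcross x y = -lcross y x := by
    ext i; fin_cases i <;> simp [lcross] <;> ring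
  rw [hanti, smul_neg, ← neg_smul, neg_neg, mdot_comm y x] at he'
  have hff : 0 < mdot (axial (g : Matrix (Fin 3) (Fin 3) ℝ)) (axial g) := by
    rw [mdot_axial_self hG.1 hG.2.1]; exact mul_pos (by linarith) (by linarith)
  have hff' : 0 < mdot (axial (h : Matrix (Fin 3) (Fin 3) ℝ)) (axial h) := by
    rw [mdot_axial_self hH.1 hH.2.1]; exact mul_pos (by linarith) (by linarith)
  obtain ⟨K, hK, hret⟩ := exists_compact_returning hγ hη hgx hhy (axial_fixed hG.1 hG.2.1)
    (axial_fixed hH.1 hH.2.1) ho ho' (div_pos hpos hff) (div_neg_of_neg_of_pos hneg hff') hb hr0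
    hr1 (neg_pos.mpr (div_neg_of_pos_of_neg hk hxy)) (div_pos_of_neg_of_neg hk' hxy) he he' hq
  choose n hn using hret
  refine Set.infinite_of_injective_forall_mem
    (pow_mul_pow_injective hD hso hg hh hne hγ hη hy0 hyy hr0 hr1 hhy n) (fun m => ?_) (hΓ K hK)
  obtain ⟨P, hP, hP'⟩ := hn m
  exact ⟨Γ.mul_mem (Γ.pow_mem hηΓ _) (Γ.pow_mem hγΓ _), _, ⟨P, hP, rfl⟩, hP'⟩

lemma margulis_mul_pos (hD : oneIsolated D)
    (hso : ∀ G ∈ D, inSO21p (G : Matrix (Fin 3) (Fin 3) ℝ)) (hΓ : properlyDisc Γ)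
    {g h : GL (Fin 3) ℝ} (hg : g ∈ D) (hh : h ∈ D) (hne : g * h ≠ h * g)
    (hTg : 3 ≤ (g : Matrix (Fin 3) (Fin 3) ℝ).trace)
    (hTh : 3 ≤ (h : Matrix (Fin 3) (Fin 3) ℝ).trace)
    {γ η : Equiv.Perm V3} {u w : V3} (hγΓ : γ ∈ Γ) (hηΓ : η ∈ Γ)
    (hγ : isAff γ g u) (hη : isAff η h w) (hα : mdot u (axial g) ≠ 0)
    (hβ : mdot w (axial h) ≠ 0) : 0 < mdot u (axial g) * mdot w (axial h) := by
  obtain ⟨g', hg', γ', hγΓ', u', hγ', hTg', hne', hs⟩ :=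
    exists_hyperbolic_same_sign hD hso hg hh hne hTg hγΓ hηΓ hγ hη hα
  obtain ⟨h', hh', η', hηΓ', w', hη', hTh', hne'', hs'⟩ :=
    exists_hyperbolic_same_sign hD hso hh hg' hne'.symm hTh hηΓ hγΓ' hη hγ' hβ
  have h1 := not_opposite_signs hD hso hΓ hg' hh' hne''.symm hTg' hTh' hγΓ' hηΓ' hγ' hη'
  have h2 := not_opposite_signs hD hso hΓ hh' hg' hne'' hTh' hTg' hηΓ' hγΓ' hη' hγ'
  rcases hα.lt_or_gt with hu | hu <;> rcases hβ.lt_or_gt with hw | hw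
  · exact mul_pos_of_neg_of_neg hu hw
  · exact absurd (neg_of_mul_pos_right hs hu.le) (h2 (pos_of_mul_pos_right hs' hw.le))
  · exact absurd (neg_of_mul_pos_right hs' hw.le) (h1 (pos_of_mul_pos_right hs hu.le))
  · exact mul_pos hu hw

lemma margulis_ne_zero (hΓ : freeAction Γ) {g : Matrix (Fin 3) (Fin 3) ℝ} (hg : inSO21p g)
    (hT : 3 ≤ g.trace) (h1 : g ≠ 1) {γ : Equiv.Perm V3} {u : V3} (hγΓ : γ ∈ Γ)
    (hγ : isAff γ g u) : mdot u (axial g) ≠ 0 := by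
  intro h0
  obtain ⟨o, ho⟩ := exists_mulVec_sub_eq hg.1 hg.2.1 (by linarith)
    (axial_ne_zero hg.1 hg.2.1 (by linarith) h1) (z := -u) (by rw [mdot_neg_left, h0, neg_zero])
  refine hΓ γ hγΓ ?_ o ?_
  · rintro rfl
    have hone : isAff 1 1 0 := fun x => by simp
    exact h1 (hγ.linear_eq hone)
  · rw [hγ, eq_add_of_sub_eq ho]; abel

end Signs

/-- Theorem A, sign direction: with `g₁, g₂ ∈ SO(2,1)⁰`
generating a discrete free group of rank two, `g₃ = (g₂g₁)⁻¹`, each `gᵢ`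
hyperbolic or parabolic, and affine isometries `γᵢ(x) = gᵢx + uᵢ` with
`γ₃γ₂γ₁ = id` such that `⟨γ₁, γ₂⟩` acts properly discontinuously and freely on
ℝ³, the Margulis invariants of `γ₁, γ₂, γ₃` with respect to positive fixed
vectors are either all strictly positive or all strictly negative. -/
theorem theoremA_signs
    (G1 G2 : GL (Fin 3) ℝ)
    (hso1 : inSO21p ((G1 : GL (Fin 3) ℝ) : Matrix (Fin 3) (Fin 3) ℝ))
    (hso2 : inSO21p ((G2 : GL (Fin 3) ℝ) : Matrix (Fin 3) (Fin 3) ℝ))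
    (hdiscrete : DiscreteTopology
      ((fun γ : GL (Fin 3) ℝ => (γ : Matrix (Fin 3) (Fin 3) ℝ)) ''
        (Subgroup.closure {G1, G2} : Set (GL (Fin 3) ℝ))))
    (hfree : Function.Injective (FreeGroup.lift ![G1, G2] : FreeGroup (Fin 2) →* GL (Fin 3) ℝ))
    (ht1 : isHyperbolic ((G1 : GL (Fin 3) ℝ) : Matrix (Fin 3) (Fin 3) ℝ) ∨
           isParabolic ((G1 : GL (Fin 3) ℝ) : Matrix (Fin 3) (Fin 3) ℝ))
    (ht2 : isHyperbolic ((G2 : GL (Fin 3) ℝ) : Matrix (Fin 3) (Fin 3) ℝ) ∨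
           isParabolic ((G2 : GL (Fin 3) ℝ) : Matrix (Fin 3) (Fin 3) ℝ))
    (ht3 : isHyperbolic (((G2 * G1)⁻¹ : GL (Fin 3) ℝ) : Matrix (Fin 3) (Fin 3) ℝ) ∨
           isParabolic (((G2 * G1)⁻¹ : GL (Fin 3) ℝ) : Matrix (Fin 3) (Fin 3) ℝ))
    (γ1 γ2 γ3 : Equiv.Perm V3) (u1 u2 u3 : V3)
    (hγ1 : ∀ x : V3, γ1 x = ((G1 : GL (Fin 3) ℝ) : Matrix (Fin 3) (Fin 3) ℝ).mulVec x + u1)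
    (hγ2 : ∀ x : V3, γ2 x = ((G2 : GL (Fin 3) ℝ) : Matrix (Fin 3) (Fin 3) ℝ).mulVec x + u2)
    (hγ3 : ∀ x : V3, γ3 x = (((G2 * G1)⁻¹ : GL (Fin 3) ℝ) : Matrix (Fin 3) (Fin 3) ℝ).mulVec x + u3)
    (hrel : γ3 * γ2 * γ1 = 1)
    (hproper : properlyDisc (Subgroup.closure {γ1, γ2}))
    (hfr : freeAction (Subgroup.closure {γ1, γ2})) :
    ∀ v1 v2 v3 : V3,
      positiveFixed ((G1 : GL (Fin 3) ℝ) : Matrix (Fin 3) (Fin 3) ℝ) v1 →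
      positiveFixed ((G2 : GL (Fin 3) ℝ) : Matrix (Fin 3) (Fin 3) ℝ) v2 →
      positiveFixed (((G2 * G1)⁻¹ : GL (Fin 3) ℝ) : Matrix (Fin 3) (Fin 3) ℝ) v3 →
      ((0 < mdot u1 v1 ∧ 0 < mdot u2 v2 ∧ 0 < mdot u3 v3) ∨
       (mdot u1 v1 < 0 ∧ mdot u2 v2 < 0 ∧ mdot u3 v3 < 0)) := by
  set D := Subgroup.closure {G1, G2} with hDdef
  set Γ := Subgroup.closure {γ1, γ2} with hΓdef
  have hG1 : G1 ∈ D := Subgroup.subset_closure (by simp)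
  have hG2 : G2 ∈ D := Subgroup.subset_closure (by simp)
  have hG3 : (G2 * G1)⁻¹ ∈ D := D.inv_mem (D.mul_mem hG2 hG1)
  have hγΓ1 : γ1 ∈ Γ := Subgroup.subset_closure (by simp)
  have hγΓ2 : γ2 ∈ Γ := Subgroup.subset_closure (by simp)
  have hγΓ3 : γ3 ∈ Γ := by
    rw [mul_assoc, mul_eq_one_iff_eq_inv] at hrel
    rw [hrel]
    exact Γ.inv_mem (Γ.mul_mem hγΓ2 hγΓ1)
  have hso : ∀ G ∈ D, inSO21p (G : Matrix (Fin 3) (Fin 3) ℝ) := by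
    intro G hG
    induction hG using Subgroup.closure_induction with
    | mem G hG =>
      rcases hG with rfl | rfl
      · exact hso1
      · exact hso2
    | one => exact inSO21p_one
    | mul G H _ _ hG hH => exact inSO21p_mul hG hH
    | inv G _ hG => rw [coe_inv_eq_ladj hG.1]; exact inSO21p_ladj hG
  have hD : oneIsolated D := oneIsolated_of_discreteTopology hdiscrete
  have hne : G1 * G2 ≠ G2 * G1 := by
    intro h
    have h' : FreeGroup.of (0 : Fin 2) * FreeGroup.of 1 = FreeGroup.of 1 * FreeGroup.of 0 :=
      hfree (by simpa using h)
    exact absurd h' (by decide)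
  have hne3 : G1 * (G2 * G1)⁻¹ ≠ (G2 * G1)⁻¹ * G1 := by
    intro h
    have h' : Commute G1 (G2 * G1) := Commute.inv_right_iff.mp h
    exact hne (mul_right_cancel (b := G1) (by rw [mul_assoc, h'.eq]))
  have hT : ∀ G ∈ D, isHyperbolic (G : Matrix (Fin 3) (Fin 3) ℝ) ∨
      isParabolic (G : Matrix (Fin 3) (Fin 3) ℝ) → 3 ≤ (G : Matrix (Fin 3) (Fin 3) ℝ).trace := by
    rintro G hG (h | h)
    · exact (three_lt_trace_of_isHyperbolic (hso G hG) h).le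
    · exact (trace_of_isParabolic h).ge
  have hT1 := hT _ hG1 ht1
  have hT2 := hT _ hG2 ht2
  have hT3 := hT _ hG3 ht3
  have hn1 : (G1 : Matrix (Fin 3) (Fin 3) ℝ) ≠ 1 :=
    coe_ne_one fun h => hne (by rw [h, one_mul, mul_one])
  have hn2 : (G2 : Matrix (Fin 3) (Fin 3) ℝ) ≠ 1 :=
    coe_ne_one fun h => hne (by rw [h, one_mul, mul_one])
  have hn3 : (((G2 * G1)⁻¹ : GL (Fin 3) ℝ) : Matrix (Fin 3) (Fin 3) ℝ) ≠ 1 :=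
    coe_ne_one fun h => hne3 (by rw [h, one_mul, mul_one])
  have hα1 := margulis_ne_zero hfr hso1 hT1 hn1 hγΓ1 hγ1
  have hα2 := margulis_ne_zero hfr hso2 hT2 hn2 hγΓ2 hγ2
  have hα3 := margulis_ne_zero hfr (hso _ hG3) hT3 hn3 hγΓ3 hγ3
  have h12 := margulis_mul_pos hD hso hproper hG1 hG2 hne hT1 hT2 hγΓ1 hγΓ2 hγ1 hγ2 hα1 hα2
  have h13 := margulis_mul_pos hD hso hproper hG1 hG3 hne3 hT1 hT3 hγΓ1 hγΓ3 hγ1 hγ3 hα1 hα3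
  intro v1 v2 v3 hv1 hv2 hv3
  have hax : ∀ G ∈ D, (G : Matrix (Fin 3) (Fin 3) ℝ) ≠ 1 →
      3 ≤ (G : Matrix (Fin 3) (Fin 3) ℝ).trace → ∀ v, positiveFixed G v →
      ∃ t : ℝ, 0 < t ∧ v = t • axial G := by
    intro G hG h1 hTG v hv
    have := hso G hG
    exact exists_pos_smul_axial this.1 this.2.1 hTG
      (axial_ne_zero this.1 this.2.1 (by linarith) h1) hv
  obtain ⟨t1, ht1, rfl⟩ := hax _ hG1 hn1 hT1 v1 hv1
  obtain ⟨t2, ht2, rfl⟩ := hax _ hG2 hn2 hT2 v2 hv2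
  obtain ⟨t3, ht3, rfl⟩ := hax _ hG3 hn3 hT3 v3 hv3
  simp only [mdot_smul_right]
  rcases hα1.lt_or_gt with h | h
  · exact Or.inr ⟨mul_neg_of_pos_of_neg ht1 h,
      mul_neg_of_pos_of_neg ht2 (neg_of_mul_pos_right h12 h.le),
      mul_neg_of_pos_of_neg ht3 (neg_of_mul_pos_right h13 h.le)⟩
  · exact Or.inl ⟨mul_pos ht1 h, mul_pos ht2 (pos_of_mul_pos_right h12 h.le),
      mul_pos ht3 (pos_of_mul_pos_right h13 h.le)⟩
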